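/- arXiv:2009.12761 — 2 statements merged into one kernel-verified Lean document; each statement's English description precedes it below -/
import Mathlib

section
/- Let K be a number field of degree 6 over ℚ that is Galois over ℚ with cyclic Galois group, and suppose K contains elements α and β with α³ = 21α − 7 and β² = −1 (so K is the sextic cyclic CM field ℚ(α, i) of conductor 28, whose group of roots of unity has order 4). Then there exist a generator σ of Gal(K/ℚ), a nonzero ideal 𝔠 of 𝒪_K, and a Shimura ideal character of type (σ, 𝔠). -/
open NumberField

/-- The action of `τ ∈ Gal(K/ℚ)` on ideals of the ring of integers of `K`,
via the restriction of `τ` to `𝓞 K`. -/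
noncomputable def idealConj {K : Type*} [Field K] [NumberField K] (τ : K ≃ₐ[ℚ] K)
    (I : Ideal (𝓞 K)) : Ideal (𝓞 K) :=
  Ideal.map (galRestrict ℤ ℚ K (𝓞 K) τ) I

/-- The cubic subfield `F` of `K`: the fixed field of `ρ = σ³`. -/
noncomputable def cubicFixedField {K : Type*} [Field K] [NumberField K] (σ : K ≃ₐ[ℚ] K) :
    IntermediateField ℚ K :=
  IntermediateField.fixedField (Subgroup.zpowers (σ ^ 3))

/-- A *Shimura ideal character of type `(σ, 𝔠)`* on a sextic cyclic CM field `K` with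
`σ` a generator of `Gal(K/ℚ)`, `ρ = σ³`, and `F` the cubic subfield (fixed field of `ρ`):
a map `ψ` from the nonzero ideals of `𝓞 K` coprime to `𝔠` to the nonzero elements of `K`
such that
(i)   `ψ (I * J) = ψ I * ψ J`;
(ii)  `ψ (s 𝓞 K) = s • σ⁴ s • σ⁵ s` whenever `s ≡ 1 mod 𝔠`;
(iii) for a prime `𝔭` of `𝓞 F` unramified in `K` (coprime to `𝔠`), `ψ (𝔭 𝓞 K) = N 𝔭`
      if `𝔭` splits in `K` and `ψ (𝔭 𝓞 K) = -N 𝔭` if `𝔭 𝓞 K` is prime;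
(iv)  `ψ I * ρ (ψ I) = N I` and `ψ I • 𝓞 K = I • σ⁴ I • σ⁵ I` as (fractional) ideals;
(v)   `ψ (σ I) = σ (ψ I)`.
Here the absolute norm `N` of an ideal is the cardinality of the corresponding quotient. -/
noncomputable def IsShimuraIdealChar {K : Type*} [Field K] [NumberField K]
    (σ : K ≃ₐ[ℚ] K) (𝔠 : Ideal (𝓞 K)) (ψ : Ideal (𝓞 K) → K) : Prop :=
  -- ψ takes nonzero values on nonzero ideals coprime to 𝔠
  (∀ I : Ideal (𝓞 K), I ≠ ⊥ → IsCoprime I 𝔠 → ψ I ≠ 0) ∧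
  -- (i) multiplicativity
  (∀ I J : Ideal (𝓞 K), I ≠ ⊥ → J ≠ ⊥ → IsCoprime I 𝔠 → IsCoprime J 𝔠 →
    ψ (I * J) = ψ I * ψ J) ∧
  -- (ii) value on principal ideals generated by `s ≡ 1 mod 𝔠`
  (∀ s : 𝓞 K, IsCoprime (Ideal.span {s}) 𝔠 → s - 1 ∈ 𝔠 →
    ψ (Ideal.span {s}) = (s : K) * (σ ^ 4) (s : K) * (σ ^ 5) (s : K)) ∧
  -- (iii) value on primes of the cubic subfield `F` unramified in `K`: such a prime either
  -- splits (`𝔭 𝓞 K` is a product of two distinct primes) or is inert (`𝔭 𝓞 K` is prime)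
  (∀ 𝔭 : Ideal (𝓞 (cubicFixedField σ)), 𝔭.IsPrime → 𝔭 ≠ ⊥ →
    IsCoprime (Ideal.map (algebraMap (𝓞 (cubicFixedField σ)) (𝓞 K)) 𝔭) 𝔠 →
    ((∃ Q₁ Q₂ : Ideal (𝓞 K), Q₁.IsPrime ∧ Q₂.IsPrime ∧ Q₁ ≠ Q₂ ∧
        Ideal.map (algebraMap (𝓞 (cubicFixedField σ)) (𝓞 K)) 𝔭 = Q₁ * Q₂) →
      ψ (Ideal.map (algebraMap (𝓞 (cubicFixedField σ)) (𝓞 K)) 𝔭)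
        = (Nat.card (𝓞 (cubicFixedField σ) ⧸ 𝔭) : K)) ∧
    ((Ideal.map (algebraMap (𝓞 (cubicFixedField σ)) (𝓞 K)) 𝔭).IsPrime →
      ψ (Ideal.map (algebraMap (𝓞 (cubicFixedField σ)) (𝓞 K)) 𝔭)
        = -(Nat.card (𝓞 (cubicFixedField σ) ⧸ 𝔭) : K))) ∧
  -- (iv) norm relation and ideal generation
  (∀ I : Ideal (𝓞 K), I ≠ ⊥ → IsCoprime I 𝔠 →
    ψ I * (σ ^ 3) (ψ I) = (Nat.card (𝓞 K ⧸ I) : K) ∧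
    FractionalIdeal.spanSingleton (nonZeroDivisors (𝓞 K)) (ψ I)
      = ((I * idealConj (σ ^ 4) I * idealConj (σ ^ 5) I : Ideal (𝓞 K)) :
          FractionalIdeal (nonZeroDivisors (𝓞 K)) K)) ∧
  -- (v) Galois equivariance with respect to σ
  (∀ I : Ideal (𝓞 K), I ≠ ⊥ → IsCoprime I 𝔠 → ψ (idealConj σ I) = σ (ψ I))

set_option linter.unusedSectionVars false

section aux

variable {K : Type*} [Field K] [NumberField K]

lemma aux_fixed_rat [IsGalois ℚ K] {σ : K ≃ₐ[ℚ] K} (hgen : ∀ τ : K ≃ₐ[ℚ] K, τ ∈ Subgroup.zpowers σ)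
    {x : K} (hx : σ x = x) : ∃ q : ℚ, (q : K) = x := by
  have h : x ∈ (⊥ : IntermediateField ℚ K) := by
    rw [IsGalois.mem_bot_iff_fixed]
    intro τ
    have h1 : Subgroup.zpowers σ ≤ MulAction.stabilizer (K ≃ₐ[ℚ] K) x := by
      rw [Subgroup.zpowers_le, MulAction.mem_stabilizer_iff]
      exact hx
    exact h1 (hgen τ)
  obtain ⟨q, hq⟩ := IntermediateField.mem_bot.1 h
  exact ⟨q, by simpa using hq⟩

lemma aux_rat_int {q : ℚ} (hx : IsIntegral ℤ (q : K)) : ∃ n : ℤ, q = n := by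
  have h2 : IsIntegral ℤ q := by
    have h3 : IsIntegral ℤ (algebraMap ℚ K q) := by simpa using hx
    exact (isIntegral_algebraMap_iff (algebraMap ℚ K).injective).1 h3
  obtain ⟨n, hn⟩ := IsIntegrallyClosed.isIntegral_iff.1 h2
  exact ⟨n, by simpa using hn.symm⟩

lemma aux_fixed_int [IsGalois ℚ K] {σ : K ≃ₐ[ℚ] K} (hgen : ∀ τ : K ≃ₐ[ℚ] K, τ ∈ Subgroup.zpowers σ)
    {x : K} (hx : σ x = x) (hi : IsIntegral ℤ x) : ∃ n : ℤ, (n : K) = x := by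
  obtain ⟨q, rfl⟩ := aux_fixed_rat hgen hx
  obtain ⟨n, rfl⟩ := aux_rat_int hi
  exact ⟨n, by simp⟩

lemma aux_sigma_beta [IsGalois ℚ K] {σ : K ≃ₐ[ℚ] K} (hgen : ∀ τ : K ≃ₐ[ℚ] K, τ ∈ Subgroup.zpowers σ)
    {β : K} (hβ : β ^ 2 = -1) : σ β = -β := by
  have h : σ β ^ 2 = β ^ 2 := by rw [← map_pow, hβ]; simp
  rcases sq_eq_sq_iff_eq_or_eq_neg.1 h with h | h
  · obtain ⟨q, rfl⟩ := aux_fixed_rat hgen h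
    have : q ^ 2 = -1 := by exact_mod_cast hβ
    nlinarith [sq_nonneg q]
  · exact h

lemma aux_beta_int {β : K} (hβ : β ^ 2 = -1) : IsIntegral ℤ β := by
  have : IsIntegral ℤ (β ^ 2) := by
    rw [hβ]; exact isIntegral_one.neg
  exact IsIntegral.of_pow (by norm_num) this

lemma aux_gauss [IsGalois ℚ K] {σ : K ≃ₐ[ℚ] K} (hgen : ∀ τ : K ≃ₐ[ℚ] K, τ ∈ Subgroup.zpowers σ)
    {β : K} (hβ : β ^ 2 = -1) {x : K} (hi : IsIntegral ℤ x) (hx : σ (σ x) = x) :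
    ∃ a b : ℤ, x = a + b * β := by
  have hσβ := aux_sigma_beta hgen hβ
  have hi' : IsIntegral ℤ (σ x) := hi.map σ.toAlgHom
  have hβi := aux_beta_int hβ
  obtain ⟨m, hm⟩ := aux_fixed_int hgen (x := x + σ x) (by rw [map_add, hx, add_comm]) (hi.add hi')
  obtain ⟨n, hn⟩ := aux_fixed_int hgen (x := (σ x - x) * β)
    (by rw [map_mul, map_sub, hx, hσβ]; ring) ((hi'.sub hi).mul hβi)
  obtain ⟨k, hk⟩ := aux_fixed_int hgen (x := x * σ x) (by rw [map_mul, hx, mul_comm]) (hi.mul hi')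
  have h4 : (4 * k : K) = m ^ 2 + n ^ 2 := by
    rw [hk, hm, hn]; linear_combination (-(σ x - x) ^ 2) * hβ
  have h4' : 4 * k = m ^ 2 + n ^ 2 := by exact_mod_cast h4
  have hx2 : 2 * x = m + n * β := by
    rw [hm, hn]; linear_combination (-(σ x - x)) * hβ
  have hmm : m % 2 = 0 ∧ n % 2 = 0 := by
    rcases Int.emod_two_eq_zero_or_one m with h1 | h1 <;>
    rcases Int.emod_two_eq_zero_or_one n with h2 | h2
    · exact ⟨h1, h2⟩
    all_goals
      exfalso
      obtain ⟨a, ha⟩ : ∃ a, m = 2 * a + m % 2 := ⟨m / 2, by omega⟩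
      obtain ⟨b, hb⟩ : ∃ b, n = 2 * b + n % 2 := ⟨n / 2, by omega⟩
      rw [h1] at ha; rw [h2] at hb
      subst ha hb
      ring_nf at h4'
      omega
  obtain ⟨a, rfl⟩ : ∃ a, m = 2 * a := ⟨m / 2, by omega⟩
  obtain ⟨b, rfl⟩ : ∃ a, n = 2 * a := ⟨n / 2, by omega⟩
  refine ⟨a, b, ?_⟩
  have : (2 : K) ≠ 0 := two_ne_zero
  apply mul_left_cancel₀ this
  rw [hx2]; push_cast; ring

lemma aux_order [IsGalois ℚ K] (hdeg : Module.finrank ℚ K = 6) {σ : K ≃ₐ[ℚ] K}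
    (hgen : ∀ τ : K ≃ₐ[ℚ] K, τ ∈ Subgroup.zpowers σ) : orderOf σ = 6 := by
  rw [orderOf_eq_card_of_forall_mem_zpowers hgen, IsGalois.card_aut_eq_finrank, hdeg]

lemma aux_pow_apply (σ : K ≃ₐ[ℚ] K) (x : K) : (σ ^ 2) x = σ (σ x) ∧ (σ ^ 3) x = σ (σ (σ x)) ∧
    (σ ^ 4) x = σ (σ (σ (σ x))) ∧ (σ ^ 5) x = σ (σ (σ (σ (σ x)))) ∧
    (σ ^ 6) x = σ (σ (σ (σ (σ (σ x))))) := by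
  refine ⟨rfl, rfl, rfl, rfl, rfl⟩

lemma aux_six [IsGalois ℚ K] (hdeg : Module.finrank ℚ K = 6) {σ : K ≃ₐ[ℚ] K}
    (hgen : ∀ τ : K ≃ₐ[ℚ] K, τ ∈ Subgroup.zpowers σ) (x : K) :
    σ (σ (σ (σ (σ (σ x))))) = x := by
  have h : σ ^ 6 = 1 := by rw [← aux_order hdeg hgen]; exact pow_orderOf_eq_one σ
  rw [← (aux_pow_apply σ x).2.2.2.2, h]; rfl

lemma aux_trace [IsGalois ℚ K] (hdeg : Module.finrank ℚ K = 6) {σ : K ≃ₐ[ℚ] K}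
    (hgen : ∀ τ : K ≃ₐ[ℚ] K, τ ∈ Subgroup.zpowers σ) (x : K) :
    (Algebra.trace ℚ K x : K) = x + σ x + σ (σ x) + σ (σ (σ x)) + σ (σ (σ (σ x)))
      + σ (σ (σ (σ (σ x)))) := by
  classical
  have h := trace_eq_sum_automorphisms (K := ℚ) (L := K) x
  rw [← IsCyclic.image_range_orderOf hgen, Finset.sum_image, aux_order hdeg hgen] at h
  · simp only [Finset.sum_range_succ, Finset.sum_range_zero] at h
    simpa using h
  · intro a ha b hb hab
    exact pow_injOn_Iio_orderOf (by simpa using ha) (by simpa using hb) hab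

lemma aux_norm [IsGalois ℚ K] (hdeg : Module.finrank ℚ K = 6) {σ : K ≃ₐ[ℚ] K}
    (hgen : ∀ τ : K ≃ₐ[ℚ] K, τ ∈ Subgroup.zpowers σ) (x : K) :
    (Algebra.norm ℚ x : K) = x * σ x * σ (σ x) * σ (σ (σ x)) * σ (σ (σ (σ x)))
      * σ (σ (σ (σ (σ x)))) := by
  classical
  have h := Algebra.norm_eq_prod_automorphisms (K := ℚ) (L := K) x
  rw [← IsCyclic.image_range_orderOf hgen, Finset.prod_image, aux_order hdeg hgen] at h
  · simp only [Finset.prod_range_succ, Finset.prod_range_zero] at h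
    simpa using h
  · intro a ha b hb hab
    exact pow_injOn_Iio_orderOf (by simpa using ha) (by simpa using hb) hab

/-- `x` is a primary Gaussian integer. -/
def auxPrim (β x : K) : Prop := ∃ a b : ℤ, x = a + b * β ∧ b % 2 = 0 ∧ (a + b) % 4 = 1

lemma aux_inj {β : K} (hβ : β ^ 2 = -1) {a b c d : ℤ} (h : (a + b * β : K) = c + d * β) :
    a = c ∧ b = d := by
  have h1 : ((a - c) ^ 2 + (b - d) ^ 2 : K) = 0 := by
    linear_combination (a - c - (b - d) * β) * h + (b - d) ^ 2 * hβ
  have h2 : (a - c) ^ 2 + (b - d) ^ 2 = 0 := by exact_mod_cast h1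
  have h3 : (a - c) ^ 2 = 0 := by nlinarith [sq_nonneg (a - c), sq_nonneg (b - d)]
  have h4 : (b - d) ^ 2 = 0 := by nlinarith [sq_nonneg (a - c), sq_nonneg (b - d)]
  exact ⟨by have := pow_eq_zero_iff (two_ne_zero) |>.1 h3; omega,
    by have := pow_eq_zero_iff (two_ne_zero) |>.1 h4; omega⟩

lemma aux_prim_mul {β : K} (hβ : β ^ 2 = -1) {x y : K} (hx : auxPrim β x) (hy : auxPrim β y) :
    auxPrim β (x * y) := by
  obtain ⟨a, b, rfl, hb, hab⟩ := hx
  obtain ⟨c, d, rfl, hd, hcd⟩ := hy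
  refine ⟨a * c - b * d, a * d + b * c, ?_, ?_, ?_⟩
  · push_cast; linear_combination (b * d) * hβ
  · obtain ⟨b, rfl⟩ : ∃ e, b = 2 * e := ⟨b / 2, by omega⟩
    obtain ⟨d, rfl⟩ : ∃ e, d = 2 * e := ⟨d / 2, by omega⟩
    ring_nf; omega
  · obtain ⟨b, rfl⟩ : ∃ e, b = 2 * e := ⟨b / 2, by omega⟩
    obtain ⟨d, rfl⟩ : ∃ e, d = 2 * e := ⟨d / 2, by omega⟩
    obtain ⟨a, rfl⟩ : ∃ e, a = 4 * e + 1 - 2 * b := ⟨(a + 2 * b) / 4, by omega⟩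
    obtain ⟨c, rfl⟩ : ∃ e, c = 4 * e + 1 - 2 * d := ⟨(c + 2 * d) / 4, by omega⟩
    ring_nf; omega

lemma aux_prim_sigma [IsGalois ℚ K] {σ : K ≃ₐ[ℚ] K}
    (hgen : ∀ τ : K ≃ₐ[ℚ] K, τ ∈ Subgroup.zpowers σ)
    {β : K} (hβ : β ^ 2 = -1) {x : K} (hx : auxPrim β x) : auxPrim β (σ x) := by
  obtain ⟨a, b, rfl, hb, hab⟩ := hx
  refine ⟨a, -b, ?_, by omega, by omega⟩
  rw [map_add, map_mul, aux_sigma_beta hgen hβ]; simp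

/-- The norm to `ℚ(i)`. -/
noncomputable def auxNu (σ : K ≃ₐ[ℚ] K) (x : K) : K := x * σ (σ x) * σ (σ (σ (σ x)))

/-- The type norm. -/
noncomputable def auxPhi (σ : K ≃ₐ[ℚ] K) (x : K) : K := x * (σ ^ 4) x * (σ ^ 5) x

lemma auxNu_mul (σ : K ≃ₐ[ℚ] K) (x y : K) : auxNu σ (x * y) = auxNu σ x * auxNu σ y := by
  simp only [auxNu, map_mul]; ring

lemma auxPhi_mul (σ : K ≃ₐ[ℚ] K) (x y : K) : auxPhi σ (x * y) = auxPhi σ x * auxPhi σ y := by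
  simp only [auxPhi, map_mul]; ring

lemma auxNu_sigma (σ : K ≃ₐ[ℚ] K) (x : K) : auxNu σ (σ x) = σ (auxNu σ x) := by
  simp only [auxNu, map_mul]

lemma auxPhi_sigma (σ : K ≃ₐ[ℚ] K) (x : K) : auxPhi σ (σ x) = σ (auxPhi σ x) := by
  simp only [auxPhi, map_mul, (aux_pow_apply _ _).2.2.1, (aux_pow_apply _ _).2.2.2.1]

lemma auxNu_int (σ : K ≃ₐ[ℚ] K) {x : K} (hx : IsIntegral ℤ x) : IsIntegral ℤ (auxNu σ x) := by
  have h : ∀ y : K, IsIntegral ℤ y → IsIntegral ℤ (σ y) := fun y hy => hy.map σ.toAlgHom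
  exact (hx.mul (h _ (h _ hx))).mul (h _ (h _ (h _ (h _ hx))))

lemma auxNu_fixed [IsGalois ℚ K] (hdeg : Module.finrank ℚ K = 6) {σ : K ≃ₐ[ℚ] K}
    (hgen : ∀ τ : K ≃ₐ[ℚ] K, τ ∈ Subgroup.zpowers σ) (x : K) :
    σ (σ (auxNu σ x)) = auxNu σ x := by
  simp only [auxNu, map_mul, aux_six hdeg hgen]; ring

lemma auxNu_norm [IsGalois ℚ K] (hdeg : Module.finrank ℚ K = 6) {σ : K ≃ₐ[ℚ] K}
    (hgen : ∀ τ : K ≃ₐ[ℚ] K, τ ∈ Subgroup.zpowers σ) (x : K) :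
    (Algebra.norm ℚ x : K) = auxNu σ x * σ (auxNu σ x) := by
  rw [aux_norm hdeg hgen]
  simp only [auxNu, map_mul]; ring

lemma auxPhi_norm [IsGalois ℚ K] (hdeg : Module.finrank ℚ K = 6) {σ : K ≃ₐ[ℚ] K}
    (hgen : ∀ τ : K ≃ₐ[ℚ] K, τ ∈ Subgroup.zpowers σ) (x : K) :
    (Algebra.norm ℚ x : K) = auxPhi σ x * (σ ^ 3) (auxPhi σ x) := by
  rw [aux_norm hdeg hgen]
  simp only [auxPhi, map_mul, (aux_pow_apply _ _).2.2.1, (aux_pow_apply _ _).2.2.2.1,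
    (aux_pow_apply _ _).2.1, aux_six hdeg hgen]; ring

lemma auxNu_gauss [IsGalois ℚ K] (hdeg : Module.finrank ℚ K = 6) {σ : K ≃ₐ[ℚ] K}
    (hgen : ∀ τ : K ≃ₐ[ℚ] K, τ ∈ Subgroup.zpowers σ) {β : K} (hβ : β ^ 2 = -1)
    {x : K} (hx : IsIntegral ℤ x) : ∃ a b : ℤ, auxNu σ x = a + b * β :=
  aux_gauss hgen hβ (auxNu_int σ hx) (auxNu_fixed hdeg hgen x)

lemma aux_norm_nonneg [IsGalois ℚ K] (hdeg : Module.finrank ℚ K = 6) {σ : K ≃ₐ[ℚ] K}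
    (hgen : ∀ τ : K ≃ₐ[ℚ] K, τ ∈ Subgroup.zpowers σ) {β : K} (hβ : β ^ 2 = -1)
    {x : K} (hx : IsIntegral ℤ x) : 0 ≤ Algebra.norm ℚ x := by
  obtain ⟨a, b, h⟩ := auxNu_gauss hdeg hgen hβ hx
  have h1 := auxNu_norm hdeg hgen x
  rw [h, map_add, map_mul, aux_sigma_beta hgen hβ] at h1
  simp only [map_intCast] at h1
  have h2 : (Algebra.norm ℚ x : K) = ((a ^ 2 + b ^ 2 : ℚ) : K) := by
    push_cast; rw [h1]; linear_combination (-b ^ 2) * hβ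
  have h3 : Algebra.norm ℚ x = (a ^ 2 + b ^ 2 : ℚ) := by exact_mod_cast h2
  rw [h3]; positivity

lemma auxNu_one_mod [IsGalois ℚ K] (hdeg : Module.finrank ℚ K = 6) {σ : K ≃ₐ[ℚ] K}
    (hgen : ∀ τ : K ≃ₐ[ℚ] K, τ ∈ Subgroup.zpowers σ) {β : K} (hβ : β ^ 2 = -1)
    {x : K} (hx : IsIntegral ℤ x) : ∃ a b : ℤ, auxNu σ (1 + 4 * x) = (1 + 4 * a : ℤ) + (4 * b : ℤ) * β := by
  have h : ∀ y : K, IsIntegral ℤ y → IsIntegral ℤ (σ y) := fun y hy => hy.map σ.toAlgHom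
  have h2 := h _ (h _ hx)
  have h4 := h _ (h _ h2)
  have h4i : IsIntegral ℤ (4 : K) := by simpa using isIntegral_algebraMap (R := ℤ) (A := K) (x := 4)
  obtain ⟨y, hy, hyi⟩ : ∃ y : K, auxNu σ (1 + 4 * x) = 1 + 4 * y ∧ IsIntegral ℤ y := by
    refine ⟨x + σ (σ x) + σ (σ (σ (σ x))) + 4 * (x * σ (σ x) + x * σ (σ (σ (σ x))) +
      σ (σ x) * σ (σ (σ (σ x)))) + 4 * 4 * (x * σ (σ x) * σ (σ (σ (σ x)))), ?_, ?_⟩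
    · simp only [auxNu, map_mul, map_add, map_one, map_ofNat]; ring
    · exact ((((hx.add h2).add h4).add (h4i.mul (((hx.mul h2).add (hx.mul h4)).add (h2.mul h4)))).add
        ((h4i.mul h4i).mul ((hx.mul h2).mul h4)))
  have hfix := auxNu_fixed hdeg hgen (1 + 4 * x)
  rw [hy] at hfix
  simp only [map_mul, map_add, map_one, map_ofNat] at hfix
  have hfy : σ (σ y) = y := by
    apply mul_left_cancel₀ (by norm_num : (4 : K) ≠ 0)
    linear_combination hfix
  obtain ⟨a, b, hab⟩ := aux_gauss hgen hβ hyi hfy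
  refine ⟨a, b, ?_⟩
  rw [hy, hab]; push_cast; ring

lemma aux_good_of_one_mod [IsGalois ℚ K] (hdeg : Module.finrank ℚ K = 6) {σ : K ≃ₐ[ℚ] K}
    (hgen : ∀ τ : K ≃ₐ[ℚ] K, τ ∈ Subgroup.zpowers σ) {β : K} (hβ : β ^ 2 = -1)
    {x : K} (hx : IsIntegral ℤ x) : auxPrim β (auxNu σ (1 + 4 * x)) := by
  obtain ⟨a, b, h⟩ := auxNu_one_mod hdeg hgen hβ hx
  exact ⟨_, _, h, by omega, by omega⟩

/-- existence of good generators -/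
lemma aux_good_exists [IsGalois ℚ K] (hdeg : Module.finrank ℚ K = 6) {σ : K ≃ₐ[ℚ] K}
    (hgen : ∀ τ : K ≃ₐ[ℚ] K, τ ∈ Subgroup.zpowers σ) {β : K} (hβ : β ^ 2 = -1)
    {s w x : K} (hs : IsIntegral ℤ s) (hw : IsIntegral ℤ w) (hx : IsIntegral ℤ x)
    (h : s * w = 1 + 4 * x) :
    auxPrim β (auxNu σ s) ∨ auxPrim β (auxNu σ (-s)) ∨ auxPrim β (auxNu σ (β * s)) ∨
      auxPrim β (auxNu σ (-(β * s))) := by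
  obtain ⟨a, b, h1⟩ := auxNu_one_mod hdeg hgen hβ hx
  rw [← h, auxNu_mul] at h1
  obtain ⟨c, d, hcd⟩ := auxNu_gauss hdeg hgen hβ hs
  obtain ⟨e, f, hef⟩ := auxNu_gauss hdeg hgen hβ hw
  have hneg : ∀ y, auxNu σ (-y) = - auxNu σ y := by
    intro y; simp only [auxNu, map_neg]; ring
  have hbeta : ∀ y, auxNu σ (β * y) = - β * auxNu σ y := by
    intro y; simp only [auxNu, map_neg, map_mul, aux_sigma_beta hgen hβ, neg_neg]
    linear_combination (β * y * σ (σ y) * σ (σ (σ (σ y)))) * hβ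
  have h2 : (((c * e - d * f : ℤ) : K) + ((c * f + d * e : ℤ) : K) * β)
      = (1 + 4 * a : ℤ) + (4 * b : ℤ) * β := by
    rw [← h1, hcd, hef]; push_cast; linear_combination (-(d * f : K)) * hβ
  obtain ⟨h3, h4⟩ := aux_inj hβ h2
  have hodd : (c + d) % 2 = 1 := by
    by_contra hc
    obtain ⟨g, hg⟩ : ∃ g, d = 2 * g - c := ⟨(c + d) / 2, by omega⟩
    subst hg
    have : (c * e - (2 * g - c) * f) + (c * f + (2 * g - c) * e) = 1 + 4 * a + 4 * b := by
      rw [h3, h4]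
    ring_nf at this
    omega
  rw [hneg, hneg, hbeta, hcd]
  by_cases hd : d % 2 = 0
  · by_cases h5 : (c + d) % 4 = 1
    · left; exact ⟨c, d, rfl, hd, h5⟩
    · right; left; exact ⟨-c, -d, by push_cast; ring, by omega, by omega⟩
  · by_cases h5 : (d - c) % 4 = 1
    · right; right; left
      exact ⟨d, -c, by push_cast; linear_combination (-d : K) * hβ, by omega, by omega⟩
    · right; right; right
      exact ⟨-d, c, by push_cast; linear_combination (d : K) * hβ, by omega, by omega⟩

lemma aux_totient {k : ℕ} (h4 : 4 ∣ k) (h : k.totient ∣ 6) : k = 4 := by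
  have h8 : ¬ 8 ∣ k := fun h8 => by
    have := (Nat.totient_dvd_of_dvd h8).trans h
    revert this; decide
  obtain ⟨m, rfl⟩ := h4
  suffices hm : m = 1 by rw [hm]
  by_contra hm
  obtain ⟨p, hp, hpm⟩ := Nat.exists_prime_and_dvd hm
  have hp2 : p ≠ 2 := by
    rintro rfl
    exact h8 (by simpa using Nat.mul_dvd_mul (dvd_refl 4) hpm)
  have h1 : (4 * p).totient ∣ 6 := (Nat.totient_dvd_of_dvd (Nat.mul_dvd_mul (dvd_refl 4) hpm)).trans h
  have hc : Nat.Coprime 4 p := by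
    have := (Nat.coprime_primes Nat.prime_two hp).2 hp2.symm
    exact Nat.Coprime.pow_left 2 this
  rw [Nat.totient_mul hc, Nat.totient_prime hp, show Nat.totient 4 = 2 by decide] at h1
  have h3 : p - 1 ∣ 3 := Nat.dvd_of_mul_dvd_mul_left (by norm_num : 0 < 2) (by simpa using h1)
  rcases (Nat.dvd_prime Nat.prime_three).1 h3 with h | h
  · omega
  · have : p = 4 := by omega
    subst this; revert hp; decide

lemma aux_tc {β : K} (hβ : β ^ 2 = -1) : IsTotallyComplex K := by
  constructor
  intro v
  by_contra hv
  rw [InfinitePlace.not_isComplex_iff_isReal] at hv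
  have h := congrArg (InfinitePlace.embedding_of_isReal hv) hβ
  simp only [map_pow, map_neg, map_one] at h
  nlinarith [sq_nonneg (InfinitePlace.embedding_of_isReal hv β)]

lemma aux_conj [IsGalois ℚ K] (hdeg : Module.finrank ℚ K = 6) {σ : K ≃ₐ[ℚ] K}
    (hgen : ∀ τ : K ≃ₐ[ℚ] K, τ ∈ Subgroup.zpowers σ) {β : K} (hβ : β ^ 2 = -1)
    (φ : K →+* ℂ) (x : K) : φ ((σ ^ 3) x) = starRingEnd ℂ (φ x) := by
  classical
  have := aux_tc hβ
  have : IsCyclic (K ≃ₐ[ℚ] K) := ⟨⟨σ, hgen⟩⟩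
  have : IsMulCommutative (K ≃ₐ[ℚ] K) := ⟨⟨fun a b => by
    obtain ⟨m, rfl⟩ := hgen a
    obtain ⟨n, rfl⟩ := hgen b
    exact (Commute.refl σ).zpow_zpow m n⟩⟩
  have : IsAbelianGalois ℚ K := {}
  let c : K ≃ₐ[ℚ] K := (IsCMField.complexConj K).restrictScalars ℚ
  have hcx : ∀ y, c y = IsCMField.complexConj K y := fun y => rfl
  have hc1 : c ≠ 1 := by
    intro h
    apply IsCMField.complexConj_ne_one K
    ext y
    rw [← hcx, h]; rfl
  have hc2 : c * c = 1 := by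
    ext y
    show c (c y) = y
    rw [hcx, hcx, IsCMField.complexConj_apply_apply]
  have hc3 : c = σ ^ 3 := by
    have : c ∈ (Finset.univ : Finset (K ≃ₐ[ℚ] K)) := Finset.mem_univ _
    rw [← IsCyclic.image_range_orderOf hgen, aux_order hdeg hgen] at this
    obtain ⟨k, hk, hkc⟩ := Finset.mem_image.1 this
    have hk6 := Finset.mem_range.1 hk
    rw [← hkc, ← pow_add] at hc2
    have hd := orderOf_dvd_of_pow_eq_one hc2
    rw [aux_order hdeg hgen] at hd
    have : k = 0 ∨ k = 3 := by omega
    rcases this with rfl | rfl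
    · exact absurd hkc.symm (by simpa using hc1)
    · exact hkc.symm
  rw [← hc3, hcx]
  exact IsCMField.complexEmbedding_complexConj K φ x

lemma aux_roots [IsGalois ℚ K] (hdeg : Module.finrank ℚ K = 6) {σ : K ≃ₐ[ℚ] K}
    (hgen : ∀ τ : K ≃ₐ[ℚ] K, τ ∈ Subgroup.zpowers σ) {β : K} (hβ : β ^ 2 = -1)
    {x : K} (hi : IsIntegral ℤ x) (hx : x * (σ ^ 3) x = 1) :
    x = 1 ∨ x = -1 ∨ x = β ∨ x = -β := by
  have hnorm : ∀ φ : K →+* ℂ, ‖φ x‖ = 1 := by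
    intro φ
    have h := congrArg φ hx
    rw [map_mul, aux_conj hdeg hgen hβ, Complex.mul_conj, map_one, Complex.normSq_eq_norm_sq] at h
    have h2 : ‖φ x‖ ^ 2 = 1 := by exact_mod_cast h
    exact (pow_eq_one_iff_of_nonneg (norm_nonneg _) two_ne_zero).1 h2
  obtain ⟨n, hn, hxn⟩ := Embeddings.pow_eq_one_of_norm_eq_one K ℂ hi hnorm
  have hfin : IsOfFinOrder x := isOfFinOrder_iff_pow_eq_one.2 ⟨n, hn, hxn⟩
  have h1 : IsPrimitiveRoot x (orderOf x) := IsPrimitiveRoot.orderOf x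
  have hβ1 : β ≠ 1 := by rintro rfl; norm_num at hβ
  have h2 : IsPrimitiveRoot β 4 := by
    have hp : β ^ 2 ^ (1 + 1) = 1 := by
      have : β ^ 4 = (β ^ 2) ^ 2 := by ring
      norm_num; rw [this, hβ]; norm_num
    have hp' : ¬ β ^ 2 ^ 1 = 1 := by
      rw [pow_one, hβ]; norm_num
    have := orderOf_eq_prime_pow (p := 2) hp' hp
    have h4 := IsPrimitiveRoot.orderOf β
    rw [this] at h4; exact h4
  have hpos : orderOf x ≠ 0 := hfin.orderOf_pos.ne'
  have h3 := h1.pow_mul_pow_lcm h2 hpos (by norm_num)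
  set k := Nat.lcm (orderOf x) 4 with hk
  have hkpos : 0 < k := Nat.lcm_pos hfin.orderOf_pos (by norm_num)
  have h4 := minpoly.degree_dvd (K := ℚ) (L := K) (h3.isIntegral hkpos).tower_top
  rw [← Polynomial.cyclotomic_eq_minpoly_rat h3 hkpos, Polynomial.natDegree_cyclotomic, hdeg] at h4
  have hk4 := aux_totient (Nat.dvd_lcm_right _ _) h4
  have h5 : orderOf x ∣ 4 := by
    rw [← hk4]; exact Nat.dvd_lcm_left _ _
  have h6 : x ^ 4 = 1 := orderOf_dvd_iff_pow_eq_one.1 h5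
  have h7 : (x - 1) * ((x + 1) * ((x - β) * (x + β))) = 0 := by
    linear_combination h6 - (x ^ 2 - 1) * hβ
  rcases mul_eq_zero.1 h7 with h | h
  · left; exact sub_eq_zero.1 h
  rcases mul_eq_zero.1 h with h | h
  · right; left; exact eq_neg_of_add_eq_zero_left h
  rcases mul_eq_zero.1 h with h | h
  · right; right; left; exact sub_eq_zero.1 h
  · right; right; right; exact eq_neg_of_add_eq_zero_left h

lemma aux_not_beta [IsGalois ℚ K] (hdeg : Module.finrank ℚ K = 6) {σ : K ≃ₐ[ℚ] K}
    (hgen : ∀ τ : K ≃ₐ[ℚ] K, τ ∈ Subgroup.zpowers σ) {β : K} (hβ : β ^ 2 = -1)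
    {s : K} (hs : s ≠ 0) {r : ℚ} (hr : Algebra.norm ℚ s = r ^ 2) : σ (σ (σ s)) ≠ β * s := by
  intro h
  have hσβ := aux_sigma_beta hgen hβ
  have hp : σ (σ (σ ((1 + β) * s))) = (1 + β) * s := by
    simp only [map_mul, map_add, map_one, hσβ, map_neg, neg_neg, h]
    linear_combination (-s) * hβ
  set p := (1 + β) * s with hpdef
  obtain ⟨q, hq⟩ := aux_fixed_rat hgen (x := p * σ p * σ (σ p)) (by
    simp only [map_mul, hp]; ring)
  have h1 := aux_norm hdeg hgen p
  rw [hp] at h1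
  have h2 : Algebra.norm ℚ p = q ^ 2 := by
    have : (Algebra.norm ℚ p : K) = ((q ^ 2 : ℚ) : K) := by
      rw [h1]; push_cast; rw [hq]; ring
    exact_mod_cast this
  have h3 : Algebra.norm ℚ (1 + β) = 8 := by
    have : (Algebra.norm ℚ (1 + β) : K) = ((8 : ℚ) : K) := by
      rw [aux_norm hdeg hgen]
      simp only [map_add, map_one, hσβ, map_neg, neg_neg]
      push_cast
      linear_combination (-(β ^ 4 - 4 * β ^ 2 + 7)) * hβ
    exact_mod_cast this
  rw [hpdef, map_mul, h3, hr] at h2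
  have hr0 : r ≠ 0 := by
    rintro rfl
    have : Algebra.norm ℚ s = 0 := by rw [hr]; ring
    exact hs (Algebra.norm_eq_zero_iff.1 this)
  have h8 : IsSquare (8 : ℚ) := ⟨q / r, by field_simp; linarith⟩
  revert h8
  rw [Rat.isSquare_iff]
  rintro ⟨h, -⟩
  have h9 : IsSquare (8 : ℤ) := h
  obtain ⟨a, ha⟩ := h9
  have : a ≤ 2 := by nlinarith
  have : -2 ≤ a := by nlinarith
  interval_cases a <;> omega

lemma aux_real_good [IsGalois ℚ K] (hdeg : Module.finrank ℚ K = 6) {σ : K ≃ₐ[ℚ] K}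
    (hgen : ∀ τ : K ≃ₐ[ℚ] K, τ ∈ Subgroup.zpowers σ) {β : K} (hβ : β ^ 2 = -1)
    {s : K} (hs : s ≠ 0) {r : ℚ} (hr : Algebra.norm ℚ s = r ^ 2) {ζ : K} (hζ : IsIntegral ℤ ζ)
    (hsζ : (σ ^ 3) s = ζ * s) (hp : auxPrim β (auxNu σ s)) :
    ∃ a : ℤ, a % 4 = 1 ∧ auxPhi σ s = a ∧ (a : ℚ) ^ 2 = r ^ 2 := by
  have h6 := aux_six hdeg hgen
  have hσβ := aux_sigma_beta hgen hβ
  have h1 : ζ * (σ ^ 3) ζ = 1 := by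
    have hs' : σ (σ (σ s)) = ζ * s := hsζ
    have h : s = σ (σ (σ (ζ * s))) := by rw [← hs', h6]
    simp only [map_mul] at h
    rw [hs'] at h
    rw [(aux_pow_apply _ _).2.1]
    apply mul_right_cancel₀ hs
    linear_combination -h
  rw [(aux_pow_apply _ _).2.1] at hsζ
  obtain ⟨a, b, hab, hb, hab4⟩ := hp
  have hphi : auxPhi σ s = s * σ (σ (σ (σ s))) * σ (σ (σ (σ (σ s)))) := rfl
  have hN := auxNu_norm hdeg hgen s
  rcases aux_roots hdeg hgen hβ hζ h1 with rfl | rfl | rfl | rfl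
  · rw [one_mul] at hsζ
    have h2 : σ (auxNu σ s) = auxNu σ s := by
      simp only [auxNu, map_mul, hsζ]; ring
    have h3 := h2
    rw [hab, map_add, map_mul, hσβ] at h3
    simp only [map_intCast] at h3
    have h4 : ((a : K) + ((-b : ℤ) : K) * β) = a + b * β := by rw [← h3]; push_cast; ring
    have h5 : b = 0 := by have := (aux_inj hβ h4).2; omega
    subst h5
    have hna : auxNu σ s = a := by rw [hab]; simp
    refine ⟨a, by omega, ?_, ?_⟩
    · rw [← hna, hphi]; simp only [auxNu, hsζ]; ring
    · rw [h2, hna, hr] at hN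
      have : (((r ^ 2 : ℚ)) : K) = ((a ^ 2 : ℚ) : K) := by rw [hN]; push_cast; ring
      exact_mod_cast this.symm
  · exfalso
    have h2 : σ (auxNu σ s) = - auxNu σ s := by
      simp only [auxNu, map_mul, hsζ, map_neg, map_one]; ring
    rw [hab, map_add, map_mul, hσβ] at h2
    simp only [map_intCast] at h2
    have h4 : ((a : K) + ((-b : ℤ) : K) * β) = (-a : ℤ) + (-b : ℤ) * β := by
      push_cast; linear_combination h2
    have := (aux_inj hβ h4).1
    omega
  · exact absurd hsζ (aux_not_beta hdeg hgen hβ hs hr)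
  · exact absurd hsζ (aux_not_beta (β := -β) hdeg hgen (by rw [neg_sq, hβ]) hs hr)

lemma aux_z_irr {q : ℚ} (h : (q : K) ^ 3 = q ^ 2 + 2 * q - 1) : False := by
  have hq : q ^ 3 = q ^ 2 + 2 * q - 1 := by exact_mod_cast h
  have hi : IsIntegral ℤ q := by
    refine ⟨Polynomial.X ^ 3 - Polynomial.X ^ 2 - 2 * Polynomial.X + 1, by monicity!, ?_⟩
    simp [Polynomial.eval₂_add, Polynomial.eval₂_sub, Polynomial.eval₂_mul]
    linear_combination hq
  obtain ⟨n, hn⟩ := IsIntegrallyClosed.isIntegral_iff.1 hi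
  have hn' : (n : ℚ) = q := by simpa using hn
  rw [← hn'] at hq
  have hz : n ^ 3 = n ^ 2 + 2 * n - 1 := by exact_mod_cast hq
  rcases Int.emod_two_eq_zero_or_one n with h1 | h1
  · obtain ⟨a, rfl⟩ : ∃ a, n = 2 * a := ⟨n / 2, by omega⟩
    ring_nf at hz; omega
  · obtain ⟨a, rfl⟩ : ∃ a, n = 2 * a + 1 := ⟨n / 2, by omega⟩
    ring_nf at hz; omega

lemma aux_z_int {z : K} (hz : z ^ 3 = z ^ 2 + 2 * z - 1) : IsIntegral ℤ z := by
  refine ⟨Polynomial.X ^ 3 - Polynomial.X ^ 2 - 2 * Polynomial.X + 1, by monicity!, ?_⟩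
  simp [Polynomial.eval₂_add, Polynomial.eval₂_sub, Polynomial.eval₂_mul]
  linear_combination hz

lemma aux_gen_z [IsGalois ℚ K] {σ : K ≃ₐ[ℚ] K}
    (hgen : ∀ τ : K ≃ₐ[ℚ] K, τ ∈ Subgroup.zpowers σ) {z : K} (hz : z ^ 3 = z ^ 2 + 2 * z - 1) :
    σ z = 2 - z ^ 2 ∨ σ z = z ^ 2 - z - 1 := by
  have h1 : σ z ^ 3 = σ z ^ 2 + 2 * σ z - 1 := by
    have := congrArg σ hz
    simpa only [map_pow, map_add, map_sub, map_mul, map_one, map_ofNat] using this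
  have h2 : (σ z - z) * ((σ z - (2 - z ^ 2)) * (σ z - (z ^ 2 - z - 1))) = 0 := by
    generalize σ z = y at h1
    linear_combination h1 + (-y * z + z ^ 2 - 1) * hz
  rcases mul_eq_zero.1 h2 with h | h
  · exfalso
    obtain ⟨q, rfl⟩ := aux_fixed_rat hgen (sub_eq_zero.1 h)
    exact aux_z_irr hz
  rcases mul_eq_zero.1 h with h | h
  · left; exact sub_eq_zero.1 h
  · right; exact sub_eq_zero.1 h

lemma aux_exists_gen [IsGalois ℚ K] (hcyc : IsCyclic (K ≃ₐ[ℚ] K)) {z : K}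
    (hz : z ^ 3 = z ^ 2 + 2 * z - 1) :
    ∃ σ : K ≃ₐ[ℚ] K, (∀ τ : K ≃ₐ[ℚ] K, τ ∈ Subgroup.zpowers σ) ∧ σ z = 2 - z ^ 2 := by
  obtain ⟨σ, hgen⟩ := hcyc
  rcases aux_gen_z hgen hz with h | h
  · exact ⟨σ, hgen, h⟩
  · have hgen' : ∀ τ : K ≃ₐ[ℚ] K, τ ∈ Subgroup.zpowers σ⁻¹ := by
      intro τ; rw [Subgroup.zpowers_inv]; exact hgen τ
    refine ⟨σ⁻¹, hgen', ?_⟩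
    rcases aux_gen_z hgen' hz with h' | h'
    · exact h'
    · exfalso
      have h3 : σ (σ⁻¹ z) = z := AlgEquiv.apply_symm_apply σ z
      rw [h'] at h3
      simp only [map_pow, map_sub, map_one, h] at h3
      have h4 : (z - 1) * (z + 2) = 0 := by
        linear_combination -h3 + (z - 1) * hz
      rcases mul_eq_zero.1 h4 with h | h
      · have : z = ((1 : ℚ) : K) := by push_cast; exact sub_eq_zero.1 h
        rw [this] at hz; exact aux_z_irr hz
      · have : z = ((-2 : ℚ) : K) := by push_cast; exact eq_neg_of_add_eq_zero_left h
        rw [this] at hz; exact aux_z_irr hz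

lemma aux_trace_form [IsGalois ℚ K] (hdeg : Module.finrank ℚ K = 6) {σ : K ≃ₐ[ℚ] K}
    (hgen : ∀ τ : K ≃ₐ[ℚ] K, τ ∈ Subgroup.zpowers σ) {β : K} (hβ : β ^ 2 = -1)
    {z : K} (hz : z ^ 3 = z ^ 2 + 2 * z - 1) (hσz : σ z = 2 - z ^ 2) {x : K}
    (a b c d e f : ℤ) (hx : x = a + b * z + c * z ^ 2 + (d + e * z + f * z ^ 2) * β) :
    Algebra.trace ℚ K x = ((6 * a + 2 * b + 10 * c : ℤ) : ℚ) := by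
  have h1 := aux_sigma_beta hgen hβ
  have h2 : σ (σ z) = z ^ 2 - z - 1 := by
    rw [hσz, map_sub, map_pow, hσz, map_ofNat]
    linear_combination (-z - 1) * hz
  have h3 : σ (σ (σ z)) = z := by
    rw [h2]; simp only [map_sub, map_pow, hσz, map_one]
    linear_combination (z + 1) * hz
  have h4 : (Algebra.trace ℚ K x : K) = ((6 * a + 2 * b + 10 * c : ℤ) : ℚ) := by
    rw [aux_trace hdeg hgen, hx]
    obtain ⟨y, hy⟩ : ∃ y, y = 2 - z ^ 2 := ⟨_, rfl⟩
    obtain ⟨w, hw⟩ : ∃ w, w = z ^ 2 - z - 1 := ⟨_, rfl⟩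
    rw [hσz, ← hy, ← hw] at h2
    rw [hσz, ← hy, h2] at h3
    rw [← hy] at hσz
    simp only [map_add, map_mul, map_pow, map_intCast, h3, h2, hσz, h1, map_neg, neg_neg]
    push_cast
    rw [hy, hw]
    linear_combination (4 * c * (z - 0)) * hz
  exact_mod_cast h4

lemma aux_discr [IsGalois ℚ K] (hdeg : Module.finrank ℚ K = 6) {σ : K ≃ₐ[ℚ] K}
    (hgen : ∀ τ : K ≃ₐ[ℚ] K, τ ∈ Subgroup.zpowers σ) {β : K} (hβ : β ^ 2 = -1)
    {z : K} (hz : z ^ 3 = z ^ 2 + 2 * z - 1) (hσz : σ z = 2 - z ^ 2) :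
    |discr K| ≤ 153664 := by
  classical
  let zz : 𝓞 K := ⟨z, aux_z_int hz⟩
  let bb : 𝓞 K := ⟨β, aux_beta_int hβ⟩
  let v : Fin 3 × Fin 2 → 𝓞 K := fun i => zz ^ (i.1 : ℕ) * bb ^ (i.2 : ℕ)
  let A : Matrix (Fin 3) (Fin 3) ℤ := !![3, 1, 5; 1, 5, 4; 5, 4, 13]
  let B : Matrix (Fin 2) (Fin 2) ℤ := !![2, 0; 0, -2]
  have htr : Algebra.traceMatrix ℤ v = Matrix.kroneckerMap (fun x y => x * y) A B := by
    ext ⟨i, j⟩ ⟨i', j'⟩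
    rw [Algebra.traceMatrix_apply, Algebra.traceForm_apply, Matrix.kroneckerMap_apply]
    have hc : ((Algebra.trace ℤ (𝓞 K) (v (i, j) * v (i', j')) : ℤ) : ℚ) =
        Algebra.trace ℚ K ((v (i, j) * v (i', j') : 𝓞 K) : K) := Algebra.coe_trace_int _
    have hv : ((v (i, j) * v (i', j') : 𝓞 K) : K) = z ^ (i : ℕ) * β ^ (j : ℕ) * (z ^ (i' : ℕ) * β ^ (j' : ℕ)) := by
      simp only [v, map_mul, map_pow]; rfl
    rw [hv] at hc
    have key := fun x a b c d e f h => aux_trace_form (x := x) hdeg hgen hβ hz hσz a b c d e f h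
    suffices hs : Algebra.trace ℚ K (z ^ (i : ℕ) * β ^ (j : ℕ) * (z ^ (i' : ℕ) * β ^ (j' : ℕ)))
        = ((A i i' * B j j' : ℤ) : ℚ) by
      rw [hs] at hc; exact_mod_cast hc
    have hz4 : z ^ 4 = 3 * z ^ 2 + z - 1 := by linear_combination (z + 1) * hz
    have hT : ∃ a b c : ℤ, z ^ (i : ℕ) * z ^ (i' : ℕ) = a + b * z + c * z ^ 2 ∧
        6 * a + 2 * b + 10 * c = 2 * A i i' := by
      have c0 : (1 : K) = (1 : ℤ) + (0 : ℤ) * z + (0 : ℤ) * z ^ 2 := by push_cast; ring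
      have c1 : z = (0 : ℤ) + (1 : ℤ) * z + (0 : ℤ) * z ^ 2 := by push_cast; ring
      have c2 : z ^ 2 = (0 : ℤ) + (0 : ℤ) * z + (1 : ℤ) * z ^ 2 := by push_cast; ring
      have c3 : z ^ 3 = (-1 : ℤ) + (2 : ℤ) * z + (1 : ℤ) * z ^ 2 := by push_cast; rw [hz]; ring
      have c4 : z ^ 4 = (-1 : ℤ) + (1 : ℤ) * z + (3 : ℤ) * z ^ 2 := by push_cast; rw [hz4]; ring
      rw [← pow_add]
      fin_cases i <;> fin_cases i'
      · exact ⟨1, 0, 0, (pow_zero z).trans c0, rfl⟩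
      · exact ⟨0, 1, 0, (pow_one z).trans c1, rfl⟩
      · exact ⟨0, 0, 1, c2, rfl⟩
      · exact ⟨0, 1, 0, (pow_one z).trans c1, rfl⟩
      · exact ⟨0, 0, 1, c2, rfl⟩
      · exact ⟨-1, 2, 1, c3, rfl⟩
      · exact ⟨0, 0, 1, c2, rfl⟩
      · exact ⟨-1, 2, 1, c3, rfl⟩
      · exact ⟨-1, 1, 3, c4, rfl⟩
    obtain ⟨a, b, c, habc, hA⟩ := hT
    have hre : z ^ (i : ℕ) * β ^ (j : ℕ) * (z ^ (i' : ℕ) * β ^ (j' : ℕ)) =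
      (a + b * z + c * z ^ 2) * (β ^ (j : ℕ) * β ^ (j' : ℕ)) := by rw [← habc]; ring
    rw [hre]
    fin_cases j <;> fin_cases j'
    · rw [key _ a b c 0 0 0 (by simp), hA]; simp [B]; ring
    · rw [key _ 0 0 0 a b c (by simp)]; simp [B]
    · rw [key _ 0 0 0 a b c (by simp)]; simp [B]
    · rw [key _ (-a) (-b) (-c) 0 0 0 (by
        simp; linear_combination (a + b * z + c * z ^ 2) * hβ),
        show 6 * -a + 2 * -b + 10 * -c = -(2 * A i i') by rw [← hA]; ring]
      simp [B]; ring
  have hdet : Algebra.discr ℤ v = -153664 := by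
    rw [Algebra.discr_def, htr, Matrix.det_kronecker]
    simp [A, B, Matrix.det_fin_three, Matrix.det_fin_two]
  have hcard : Fintype.card (Fin 3 × Fin 2) = Fintype.card (Module.Free.ChooseBasisIndex ℤ (𝓞 K)) := by
    rw [← Module.finrank_eq_card_chooseBasisIndex, RingOfIntegers.rank, hdeg]; simp
  let e := Fintype.equivOfCardEq hcard
  let b := (RingOfIntegers.basis K).reindex e.symm
  have hb : Algebra.discr ℤ b = discr K := NumberField.discr_eq_discr K b
  have hvb : v = Matrix.vecMul b ((b.toMatrix v).map (algebraMap ℤ (𝓞 K))) := by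
    ext1 j
    have h := b.sum_toMatrix_smul_self v j
    rw [← h]
    simp only [Matrix.vecMul, dotProduct, Matrix.map_apply]
    refine Finset.sum_congr rfl fun i _ => ?_
    rw [Algebra.smul_def, mul_comm]
  rw [hvb, Algebra.discr_of_matrix_vecMul, hb] at hdet
  have hP : (b.toMatrix v).det ≠ 0 := by
    intro h; rw [h] at hdet; norm_num at hdet
  have h1 : 1 ≤ (b.toMatrix v).det ^ 2 := by
    have := sq_nonneg (b.toMatrix v).det
    have h0 : (b.toMatrix v).det ^ 2 ≠ 0 := pow_ne_zero 2 hP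
    omega
  have h2 : (b.toMatrix v).det ^ 2 * |discr K| = 153664 := by
    rw [← abs_of_nonneg (sq_nonneg (b.toMatrix v).det), ← abs_mul, hdet]; norm_num
  nlinarith [abs_nonneg (discr K)]

lemma aux_field {k : Type*} [Field k] {z b : k} {q : ℕ} (hq1 : q ≠ 1) (hq0 : q ≠ 0) (hq : q ≤ 12) (hc : (q : k) = 0)
    (hz : z ^ 3 = z ^ 2 + 2 * z - 1) (hb : b ^ 2 = -1) (hzq : z ^ q = z) (hbq : b ^ q = b) :
    q = 8 := by
  by_contra h8
  have h4 : z ^ 4 = 3 * z ^ 2 + z - 1 := by linear_combination (z + 1) * hz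
  have h5 : z ^ 5 = 4 * z ^ 2 + 5 * z - 3 := by linear_combination z * h4 + 3 * hz
  have h6 : z ^ 6 = 9 * z ^ 2 + 5 * z - 4 := by linear_combination z * h5 + 4 * hz
  have h7 : z ^ 7 = 14 * z ^ 2 + 14 * z - 9 := by linear_combination z * h6 + 9 * hz
  have h8' : z ^ 8 = 28 * z ^ 2 + 19 * z - 14 := by linear_combination z * h7 + 14 * hz
  have h9 : z ^ 9 = 47 * z ^ 2 + 42 * z - 28 := by linear_combination z * h8' + 28 * hz
  have h10 : z ^ 10 = 89 * z ^ 2 + 66 * z - 47 := by linear_combination z * h9 + 47 * hz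
  have h12 : z ^ 12 = 286 * z ^ 2 + 221 * z - 155 := by
    linear_combination z ^ 2 * h10 + 89 * h4 + 66 * hz
  have b3 : b ^ 3 = -b := by linear_combination b * hb
  have b7 : b ^ 7 = -b := by linear_combination b ^ 3 * (b ^ 2 - 1) * hb + b3
  have b11 : b ^ 11 = -b := by linear_combination b ^ 7 * (b ^ 2 - 1) * hb + b7
  have b12 : b ^ 12 = 1 := by linear_combination b * b11 - hb
  interval_cases q <;> try contradiction
  · have hp : (2 : k) = 0 := by exact_mod_cast hc
    exact one_ne_zero (α := k) (by
      linear_combination ((0) * z ^ 0 + (1) * z ^ 1 + (0) * z ^ 2) * hzq + ((1) * z ^ 0 + (0) * z ^ 1) * hz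
        - ((0) * z ^ 0 + (-1) * z ^ 1 + (-1) * z ^ 2 + (1) * z ^ 3 + (0) * z ^ 4) * hp)
  · have hp : (2 : k) = 0 := by linear_combination b * (hbq - b3) + 2 * hb
    have h3 : (3 : k) = 0 := by exact_mod_cast hc
    exact one_ne_zero (α := k) (by linear_combination h3 - hp)
  · have hb1 : b = 1 := by linear_combination (b ^ 2 - 1) * hb - hbq
    have hp : (2 : k) = 0 := by rw [hb1] at hb; linear_combination hb
    exact one_ne_zero (α := k) (by
      linear_combination ((1) * z ^ 0 + (1) * z ^ 1 + (1) * z ^ 2) * (hzq - h4) + ((0) * z ^ 0 + (1) * z ^ 1) * hz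
        - ((-1) * z ^ 0 + (0) * z ^ 1 + (0) * z ^ 2 + (1) * z ^ 3 + (2) * z ^ 4) * hp)
  · have hp : (5 : k) = 0 := by exact_mod_cast hc
    exact one_ne_zero (α := k) (by
      linear_combination ((3) * z ^ 0 + (2) * z ^ 1 + (4) * z ^ 2) * (hzq - h5) + ((0) * z ^ 0 + (4) * z ^ 1) * hz
        - ((-2) * z ^ 0 + (2) * z ^ 1 + (0) * z ^ 2 + (4) * z ^ 3 + (4) * z ^ 4) * hp)
  · have hb1 : b = -1 := by linear_combination b * b * b * b * hb - b * b * hb + hb - hbq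
    have hp : (2 : k) = 0 := by rw [hb1] at hb; linear_combination hb
    exact one_ne_zero (α := k) (by
      linear_combination ((1) * z ^ 0 + (1) * z ^ 1 + (0) * z ^ 2) * (hzq - h6) + ((1) * z ^ 0 + (0) * z ^ 1) * hz
        - ((-2) * z ^ 0 + (-1) * z ^ 1 + (6) * z ^ 2 + (5) * z ^ 3 + (0) * z ^ 4) * hp)
  · have hp : (2 : k) = 0 := by linear_combination b * (hbq - b7) + 2 * hb
    have h3 : (7 : k) = 0 := by exact_mod_cast hc
    exact one_ne_zero (α := k) (by linear_combination h3 - 3 * hp)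
  · have h3 : (9 : k) = 0 := by exact_mod_cast hc
    have hp : (3 : k) = 0 := by
      apply mul_self_eq_zero.1; linear_combination h3
    exact one_ne_zero (α := k) (by
      linear_combination ((0) * z ^ 0 + (2) * z ^ 1 + (1) * z ^ 2) * (hzq - h9) + ((1) * z ^ 0 + (1) * z ^ 1) * hz
        - ((0) * z ^ 0 + (-19) * z ^ 1 + (17) * z ^ 2 + (45) * z ^ 3 + (16) * z ^ 4) * hp)
  · have hb1 : b = -1 := by linear_combination b ^ 3 * b7 - b3 * b + hb - hbq
    have hp : (2 : k) = 0 := by rw [hb1] at hb; linear_combination hb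
    exact one_ne_zero (α := k) (by
      linear_combination ((1) * z ^ 0 + (0) * z ^ 1 + (1) * z ^ 2) * (hzq - h10) + ((0) * z ^ 0 + (1) * z ^ 1) * hz
        - ((-24) * z ^ 0 + (33) * z ^ 1 + (20) * z ^ 2 + (32) * z ^ 3 + (45) * z ^ 4) * hp)
  · have hp : (2 : k) = 0 := by linear_combination b * (hbq - b11) + 2 * hb
    have h3 : (11 : k) = 0 := by exact_mod_cast hc
    exact one_ne_zero (α := k) (by linear_combination h3 - 5 * hp)
  · have hb1 : b = 1 := by linear_combination b12 - hbq
    have hp : (2 : k) = 0 := by rw [hb1] at hb; linear_combination hb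
    exact one_ne_zero (α := k) (by
      linear_combination ((1) * z ^ 0 + (0) * z ^ 1 + (0) * z ^ 2) * (hzq - h12) + ((0) * z ^ 0 + (0) * z ^ 1) * hz
        - ((-78) * z ^ 0 + (110) * z ^ 1 + (143) * z ^ 2 + (0) * z ^ 3 + (0) * z ^ 4) * hp)

lemma aux_minkowski (hdeg : Module.finrank ℚ K = 6) {β : K} (hβ : β ^ 2 = -1)
    (hd : |discr K| ≤ 153664) {q : ℕ}
    (h : (q : ℝ) ≤ (4 / Real.pi) ^ InfinitePlace.nrComplexPlaces K *
      ((Module.finrank ℚ K).factorial / (Module.finrank ℚ K) ^ (Module.finrank ℚ K) *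
        √|(discr K : ℝ)|)) : q ≤ 12 := by
  have := aux_tc hβ
  have h3 : InfinitePlace.nrComplexPlaces K = 3 := by
    have := IsTotallyComplex.finrank (K := K)
    omega
  rw [h3, hdeg] at h
  have hs : √|(discr K : ℝ)| ≤ 392 := by
    rw [Real.sqrt_le_left (by norm_num)]
    have : ((|discr K| : ℤ) : ℝ) ≤ 153664 := by exact_mod_cast hd
    rw [Int.cast_abs] at this
    linarith
  have hpi : 4 / Real.pi ≤ 4 / 3.14 := by
    have := Real.pi_gt_d2
    gcongr
  have hpi0 : 0 ≤ 4 / Real.pi := by positivity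
  have h1 : (4 / Real.pi) ^ 3 ≤ (4 / 3.14) ^ 3 := pow_le_pow_left₀ hpi0 hpi 3
  have hf : ((Nat.factorial 6 : ℕ) : ℝ) = 720 := by norm_num [Nat.factorial]
  rw [hf] at h
  have h2 : (720 : ℝ) / ((6 : ℕ) : ℝ) ^ 6 * √|(discr K : ℝ)| ≤ 720 / 6 ^ 6 * 392 := by
    push_cast; gcongr
  have h4 := mul_le_mul h1 h2 (by positivity) (by positivity)
  have : (q : ℝ) < 13 := by
    refine (h.trans h4).trans_lt ?_
    norm_num
  have : q < 13 := by exact_mod_cast this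
  omega

lemma aux_norm_one_beta [IsGalois ℚ K] (hdeg : Module.finrank ℚ K = 6) {σ : K ≃ₐ[ℚ] K}
    (hgen : ∀ τ : K ≃ₐ[ℚ] K, τ ∈ Subgroup.zpowers σ) {β : K} (hβ : β ^ 2 = -1) :
    Algebra.norm ℚ (1 + β) = 8 := by
  have hσβ := aux_sigma_beta hgen hβ
  have : (Algebra.norm ℚ (1 + β) : K) = ((8 : ℚ) : K) := by
    rw [aux_norm hdeg hgen]
    simp only [map_add, map_one, hσβ, map_neg, neg_neg]
    push_cast
    linear_combination (-(β ^ 4 - 4 * β ^ 2 + 7)) * hβ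
  exact_mod_cast this

/-- absolute norm of a principal ideal -/
lemma aux_absNorm [IsGalois ℚ K] (hdeg : Module.finrank ℚ K = 6) {σ : K ≃ₐ[ℚ] K}
    (hgen : ∀ τ : K ≃ₐ[ℚ] K, τ ∈ Subgroup.zpowers σ) {β : K} (hβ : β ^ 2 = -1) (s : 𝓞 K) :
    ((Ideal.absNorm (Ideal.span {s}) : ℕ) : ℚ) = Algebra.norm ℚ (s : K) := by
  rw [Ideal.absNorm_span_singleton]
  have h := Algebra.coe_norm_int s
  have h0 := aux_norm_nonneg hdeg hgen hβ (RingOfIntegers.isIntegral_coe s)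
  rw [← h] at h0 ⊢
  have h1 : 0 ≤ Algebra.norm ℤ s := by exact_mod_cast h0
  rw [Nat.cast_natAbs, abs_of_nonneg h1]

lemma aux_pid [IsGalois ℚ K] (hdeg : Module.finrank ℚ K = 6) {σ : K ≃ₐ[ℚ] K}
    (hgen : ∀ τ : K ≃ₐ[ℚ] K, τ ∈ Subgroup.zpowers σ) {β : K} (hβ : β ^ 2 = -1)
    {z : K} (hz : z ^ 3 = z ^ 2 + 2 * z - 1) (hσz : σ z = 2 - z ^ 2) :
    IsPrincipalIdealRing (𝓞 K) := by
  classical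
  refine RingOfIntegers.isPrincipalIdealRing_of_isPrincipal_of_norm_le_of_isPrime
    (fun ⟨I, hI⟩ hprime hle => ?_)
  simp only at hprime hle ⊢
  have hq := aux_minkowski hdeg hβ (aux_discr hdeg hgen hβ hz hσz) hle
  have hI0 : I ≠ ⊥ := nonZeroDivisors.ne_zero hI
  have hmax : I.IsMaximal := hprime.isMaximal hI0
  obtain ⟨zz, hzc⟩ : ∃ zz : 𝓞 K, (zz : K) = z := ⟨⟨z, aux_z_int hz⟩, rfl⟩
  obtain ⟨bb, hbc⟩ : ∃ bb : 𝓞 K, (bb : K) = β := ⟨⟨β, aux_beta_int hβ⟩, rfl⟩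
  have hzz : zz ^ 3 = zz ^ 2 + 2 * zz - 1 := RingOfIntegers.ext (by simpa [← hzc, show (algebraMap (𝓞 K) K) 2 = 2 from map_ofNat _ 2] using hz)
  have hbb : bb ^ 2 = -1 := RingOfIntegers.ext (by simpa [← hbc] using hβ)
  let : Field (𝓞 K ⧸ I) := Ideal.Quotient.field I
  have hfin : Finite (𝓞 K ⧸ I) := Ideal.finiteQuotientOfFreeOfNeBot I hI0
  let : Fintype (𝓞 K ⧸ I) := Fintype.ofFinite _
  have hcard : Fintype.card (𝓞 K ⧸ I) = Ideal.absNorm I := by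
    rw [← Nat.card_eq_fintype_card]; rfl
  have hpow : ∀ x : 𝓞 K ⧸ I, x ^ Ideal.absNorm I = x := fun x => by
    rw [← hcard]; exact FiniteField.pow_card x
  have h8 : Ideal.absNorm I = 8 := by
    refine aux_field (z := Ideal.Quotient.mk I zz) (b := Ideal.Quotient.mk I bb) ?_ ?_ hq ?_ ?_ ?_
      (hpow _) (hpow _)
    · rw [Ne, Ideal.absNorm_eq_one_iff]; exact hprime.ne_top
    · rw [Ne, Ideal.absNorm_eq_zero_iff]; exact hI0
    · have := Ideal.Quotient.eq_zero_iff_mem.2 (Ideal.absNorm_mem I)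
      simpa using this
    · have := congrArg (Ideal.Quotient.mk I) hzz
      simpa only [map_pow, map_add, map_sub, map_mul, map_one, map_ofNat] using this
    · have := congrArg (Ideal.Quotient.mk I) hbb
      simpa only [map_pow, map_neg, map_one] using this
  have h2 : (2 : 𝓞 K) ∈ I := by
    have := Ideal.absNorm_mem I
    rw [h8] at this
    refine hprime.mem_of_pow_mem 3 ?_
    norm_num at this ⊢
    exact this
  have h1 : 1 + bb ∈ I := by
    refine hprime.mem_of_pow_mem 2 ?_
    have : (1 + bb) ^ 2 = bb * 2 := by linear_combination hbb
    rw [this]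
    exact I.mul_mem_left _ h2
  have hle' : Ideal.span {1 + bb} ≤ I := (Ideal.span_singleton_le_iff_mem I).2 h1
  have hN : Ideal.absNorm (Ideal.span {1 + bb}) = 8 := by
    have := aux_absNorm hdeg hgen hβ (1 + bb)
    have hc : ((1 + bb : 𝓞 K) : K) = 1 + β := by simp [hbc]
    rw [hc, aux_norm_one_beta hdeg hgen hβ] at this
    exact_mod_cast this
  obtain ⟨J, hJ⟩ := Ideal.dvd_iff_le.2 hle'
  rw [hJ, map_mul, h8] at hN
  have hJ1 : J = ⊤ := Ideal.absNorm_eq_one_iff.1 (by omega)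
  rw [hJ1, Ideal.mul_top] at hJ
  exact ⟨1 + bb, hJ.symm⟩

lemma aux_prim_eps {β : K} (hβ : β ^ 2 = -1) {x : K} (hx : auxPrim β x) :
    ¬ auxPrim β (-x) ∧ ¬ auxPrim β (β * x) ∧ ¬ auxPrim β (-(β * x)) := by
  obtain ⟨a, b, rfl, hb, hab⟩ := hx
  refine ⟨?_, ?_, ?_⟩
  · rintro ⟨c, d, h, hd, hcd⟩
    have := aux_inj hβ (a := -a) (b := -b) (c := c) (d := d) (by push_cast; linear_combination h)
    omega
  · rintro ⟨c, d, h, hd, hcd⟩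
    have := aux_inj hβ (a := -b) (b := a) (c := c) (d := d) (by
      push_cast; linear_combination h - b * hβ)
    omega
  · rintro ⟨c, d, h, hd, hcd⟩
    have := aux_inj hβ (a := b) (b := -a) (c := c) (d := d) (by
      push_cast; linear_combination h + b * hβ)
    omega

lemma auxNu_beta {σ : K ≃ₐ[ℚ] K} {β : K} (hβ : β ^ 2 = -1) (hσβ : σ β = -β) :
    auxNu σ β = -β := by
  simp only [auxNu, map_neg, hσβ, neg_neg]
  linear_combination β * hβ

lemma auxNu_neg (σ : K ≃ₐ[ℚ] K) (x : K) : auxNu σ (-x) = -auxNu σ x := by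
  simp only [auxNu, map_neg]; ring

/-- good units have trivial `Φ` -/
lemma aux_unit [IsGalois ℚ K] (hdeg : Module.finrank ℚ K = 6) {σ : K ≃ₐ[ℚ] K}
    (hgen : ∀ τ : K ≃ₐ[ℚ] K, τ ∈ Subgroup.zpowers σ) {β : K} (hβ : β ^ 2 = -1)
    (u : (𝓞 K)ˣ) (hp : auxPrim β (auxNu σ ((u : 𝓞 K) : K))) :
    auxPhi σ ((u : 𝓞 K) : K) = 1 := by
  have hu : ((u : 𝓞 K) : K) * (((u⁻¹ : (𝓞 K)ˣ) : 𝓞 K) : K) = 1 := by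
    rw [← map_mul, Units.mul_inv, map_one]
  have hN : Algebra.norm ℚ ((u : 𝓞 K) : K) = (1 : ℚ) ^ 2 := by
    rw [← aux_absNorm hdeg hgen hβ, Ideal.span_singleton_eq_top.2 u.isUnit]
    simp
  have hi : ∀ y : K, IsIntegral ℤ y → IsIntegral ℤ ((σ ^ 3) y) := fun y hy => hy.map (σ ^ 3).toAlgHom
  obtain ⟨a, ha, h1, h2⟩ := aux_real_good hdeg hgen hβ (left_ne_zero_of_mul_eq_one hu) hN
    (ζ := (σ ^ 3) ((u : 𝓞 K) : K) * (((u⁻¹ : (𝓞 K)ˣ) : 𝓞 K) : K))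
    ((hi _ (RingOfIntegers.isIntegral_coe _)).mul (RingOfIntegers.isIntegral_coe _))
    (by linear_combination (-(σ ^ 3) ((u : 𝓞 K) : K)) * hu) hp
  have h3 : a ^ 2 = 1 := by
    have : (a : ℚ) ^ 2 = 1 := by rw [h2]; norm_num
    exact_mod_cast this
  rcases (show a = 1 ∨ a = -1 by rcases mul_eq_zero.1 (show (a - 1) * (a + 1) = 0 by linear_combination h3) with h | h <;> omega) with rfl | rfl
  · rw [h1]; simp
  · omega

lemma aux_unique [IsGalois ℚ K] (hdeg : Module.finrank ℚ K = 6) {σ : K ≃ₐ[ℚ] K}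
    (hgen : ∀ τ : K ≃ₐ[ℚ] K, τ ∈ Subgroup.zpowers σ) {β : K} (hβ : β ^ 2 = -1)
    {s t : 𝓞 K} (h : Ideal.span {s} = Ideal.span {t}) (hs : auxPrim β (auxNu σ (s : K)))
    (ht : auxPrim β (auxNu σ (t : K))) : auxPhi σ (s : K) = auxPhi σ (t : K) := by
  obtain ⟨u, hu⟩ := Ideal.span_singleton_eq_span_singleton.1 h
  have huu : ((u : 𝓞 K) : K) * (((u⁻¹ : (𝓞 K)ˣ) : 𝓞 K) : K) = 1 := by
    rw [← map_mul, Units.mul_inv, map_one]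
  have hu' : (s : K) * ((u : 𝓞 K) : K) = (t : K) := by rw [← map_mul, hu]
  have hσβ := aux_sigma_beta hgen hβ
  have hν : auxNu σ (s : K) * auxNu σ ((u : 𝓞 K) : K) = auxNu σ (t : K) := by
    rw [← auxNu_mul, hu']
  obtain ⟨e1, e2, e3⟩ := aux_prim_eps hβ ht
  rcases aux_good_exists hdeg hgen hβ (RingOfIntegers.isIntegral_coe (u : 𝓞 K))
    (RingOfIntegers.isIntegral_coe ((u⁻¹ : (𝓞 K)ˣ) : 𝓞 K)) (x := 0) isIntegral_zero
    (by rw [huu]; ring) with hp | hp | hp | hp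
  · rw [← hu', auxPhi_mul, aux_unit hdeg hgen hβ u hp, mul_one]
  · have := aux_prim_mul hβ hs hp
    rw [auxNu_neg, mul_neg, hν] at this
    exact absurd this e1
  · have := aux_prim_mul hβ hs hp
    rw [auxNu_mul, auxNu_beta hβ hσβ, mul_left_comm, hν, neg_mul] at this
    exact absurd this e3
  · have := aux_prim_mul hβ hs hp
    rw [auxNu_neg, auxNu_mul, auxNu_beta hβ hσβ, mul_neg, mul_left_comm, hν, neg_mul, neg_neg]
      at this
    exact absurd this e2

lemma aux_exists_good [IsGalois ℚ K] (hdeg : Module.finrank ℚ K = 6) {σ : K ≃ₐ[ℚ] K}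
    (hgen : ∀ τ : K ≃ₐ[ℚ] K, τ ∈ Subgroup.zpowers σ) {β : K} (hβ : β ^ 2 = -1)
    [IsPrincipalIdealRing (𝓞 K)] {I : Ideal (𝓞 K)} (hc : IsCoprime I (Ideal.span {(4 : 𝓞 K)})) :
    ∃ t : 𝓞 K, I = Ideal.span {t} ∧ auxPrim β (auxNu σ (t : K)) := by
  obtain ⟨s, hs⟩ := (IsPrincipalIdealRing.principal I).principal
  replace hs : I = Ideal.span {s} := hs
  obtain ⟨i, hi, j, hj, hij⟩ := Ideal.isCoprime_iff_exists.1 hc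
  rw [hs] at hi
  obtain ⟨w, rfl⟩ := Ideal.mem_span_singleton'.1 hi
  obtain ⟨y, rfl⟩ := Ideal.mem_span_singleton'.1 hj
  obtain ⟨bb, hbc⟩ : ∃ bb : 𝓞 K, algebraMap (𝓞 K) K bb = β := ⟨⟨β, aux_beta_int hβ⟩, rfl⟩
  have hbu : IsUnit bb := by
    refine IsUnit.of_mul_eq_one (-bb) ?_
    apply RingOfIntegers.ext
    simp only [map_mul, map_neg, map_one, hbc]
    linear_combination -hβ
  have h4 : (algebraMap (𝓞 K) K) 4 = 4 := map_ofNat _ 4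
  have hK : (s : K) * (w : K) = 1 + 4 * (-(y : K)) := by
    have := congrArg (algebraMap (𝓞 K) K) hij
    simp only [map_add, map_mul, map_one, h4] at this
    linear_combination this
  rcases aux_good_exists hdeg hgen hβ (RingOfIntegers.isIntegral_coe s)
    (RingOfIntegers.isIntegral_coe w) (RingOfIntegers.isIntegral_coe y).neg hK with hp | hp | hp | hp
  · exact ⟨s, hs, hp⟩
  · exact ⟨-s, by rw [hs, Ideal.span_singleton_neg], by rwa [RingOfIntegers.coe_eq_algebraMap, map_neg]⟩
  · exact ⟨bb * s, by rw [hs, Ideal.span_singleton_mul_left_unit hbu], by rwa [RingOfIntegers.coe_eq_algebraMap, map_mul, hbc]⟩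
  · exact ⟨-(bb * s), by rw [hs, Ideal.span_singleton_neg, Ideal.span_singleton_mul_left_unit hbu],
      by rwa [RingOfIntegers.coe_eq_algebraMap, map_neg, map_mul, hbc]⟩

open Classical in
/-- the character: value of `Φ` at a good generator -/
noncomputable def auxPsi (σ : K ≃ₐ[ℚ] K) (β : K) (I : Ideal (𝓞 K)) : K :=
  if h : ∃ t : 𝓞 K, I = Ideal.span {t} ∧ auxPrim β (auxNu σ (t : K)) then
    auxPhi σ (h.choose : K) else 0

lemma auxPsi_eq [IsGalois ℚ K] (hdeg : Module.finrank ℚ K = 6) {σ : K ≃ₐ[ℚ] K}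
    (hgen : ∀ τ : K ≃ₐ[ℚ] K, τ ∈ Subgroup.zpowers σ) {β : K} (hβ : β ^ 2 = -1)
    {I : Ideal (𝓞 K)} {t : 𝓞 K} (hI : I = Ideal.span {t}) (ht : auxPrim β (auxNu σ (t : K))) :
    auxPsi σ β I = auxPhi σ (t : K) := by
  have h : ∃ t : 𝓞 K, I = Ideal.span {t} ∧ auxPrim β (auxNu σ (t : K)) := ⟨t, hI, ht⟩
  rw [auxPsi, dif_pos h]
  exact aux_unique hdeg hgen hβ (h.choose_spec.1.symm.trans hI) h.choose_spec.2 ht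

lemma aux_finrank [IsGalois ℚ K] (hdeg : Module.finrank ℚ K = 6) {σ : K ≃ₐ[ℚ] K}
    (hgen : ∀ τ : K ≃ₐ[ℚ] K, τ ∈ Subgroup.zpowers σ) :
    Module.finrank (cubicFixedField σ) K = 2 := by
  rw [cubicFixedField, IntermediateField.finrank_fixedField_eq_card, Nat.card_zpowers,
    orderOf_pow, aux_order hdeg hgen]
  decide

lemma aux_absNorm_map [IsGalois ℚ K] (hdeg : Module.finrank ℚ K = 6) {σ : K ≃ₐ[ℚ] K}
    (hgen : ∀ τ : K ≃ₐ[ℚ] K, τ ∈ Subgroup.zpowers σ) (p : Ideal (𝓞 (cubicFixedField σ))) :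
    Ideal.absNorm (Ideal.map (algebraMap (𝓞 (cubicFixedField σ)) (𝓞 K)) p)
      = Ideal.absNorm p ^ 2 := by
  rw [Ideal.absNorm_algebraMap, ← aux_finrank hdeg hgen]
  congr 1
  exact (IsFractionRing.finrank_eq (𝓞 (cubicFixedField σ)) (cubicFixedField σ)
    (𝓞 K) K).symm

lemma aux_galRestrict (τ : K ≃ₐ[ℚ] K) (x : 𝓞 K) :
    algebraMap (𝓞 K) K (galRestrict ℤ ℚ K (𝓞 K) τ x) = τ (algebraMap (𝓞 K) K x) :=
  algebraMap_galRestrict_apply ℤ τ x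

lemma aux_fix (σ : K ≃ₐ[ℚ] K) (x : 𝓞 (cubicFixedField σ)) :
    galRestrict ℤ ℚ K (𝓞 K) (σ ^ 3) (algebraMap (𝓞 (cubicFixedField σ)) (𝓞 K) x)
      = algebraMap (𝓞 (cubicFixedField σ)) (𝓞 K) x := by
  apply RingOfIntegers.ext
  rw [RingOfIntegers.coe_eq_algebraMap, aux_galRestrict]
  have h := (algebraMap (𝓞 (cubicFixedField σ)) (cubicFixedField σ) x).2
  exact (IntermediateField.mem_fixedField_iff _ _).1 h (σ ^ 3) (Subgroup.mem_zpowers _)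

lemma aux_stable (σ : K ≃ₐ[ℚ] K) (p : Ideal (𝓞 (cubicFixedField σ))) {x : 𝓞 K}
    (hx : x ∈ Ideal.map (algebraMap (𝓞 (cubicFixedField σ)) (𝓞 K)) p) :
    galRestrict ℤ ℚ K (𝓞 K) (σ ^ 3) x ∈
      Ideal.map (algebraMap (𝓞 (cubicFixedField σ)) (𝓞 K)) p := by
  have h : Ideal.map (algebraMap (𝓞 (cubicFixedField σ)) (𝓞 K)) p ≤
      Ideal.comap (galRestrict ℤ ℚ K (𝓞 K) (σ ^ 3)).toRingHom
        (Ideal.map (algebraMap (𝓞 (cubicFixedField σ)) (𝓞 K)) p) := by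
    rw [Ideal.map_le_iff_le_comap]
    intro y hy
    rw [Ideal.mem_comap, Ideal.mem_comap]
    have := aux_fix σ y
    change galRestrict ℤ ℚ K (𝓞 K) (σ ^ 3) (algebraMap (𝓞 (cubicFixedField σ)) (𝓞 K) y) ∈ _
    rw [this]
    exact Ideal.mem_map_of_mem _ hy
  exact h hx

lemma aux_prime_val [IsGalois ℚ K] (hdeg : Module.finrank ℚ K = 6) {σ : K ≃ₐ[ℚ] K}
    (hgen : ∀ τ : K ≃ₐ[ℚ] K, τ ∈ Subgroup.zpowers σ) {β : K} (hβ : β ^ 2 = -1)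
    [IsPrincipalIdealRing (𝓞 K)] {p : Ideal (𝓞 (cubicFixedField σ))} (hp0 : p ≠ ⊥)
    (hc : IsCoprime (Ideal.map (algebraMap (𝓞 (cubicFixedField σ)) (𝓞 K)) p)
      (Ideal.span {(4 : 𝓞 K)})) :
    ∃ a : ℤ, a % 4 = 1 ∧
      auxPsi σ β (Ideal.map (algebraMap (𝓞 (cubicFixedField σ)) (𝓞 K)) p) = a ∧
      (a = Ideal.absNorm p ∨ a = -Ideal.absNorm p) := by
  obtain ⟨s, hs, hg⟩ := aux_exists_good hdeg hgen hβ hc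
  have hN : Algebra.norm ℚ (s : K) = ((Ideal.absNorm p : ℕ) : ℚ) ^ 2 := by
    rw [← aux_absNorm hdeg hgen hβ, ← hs, aux_absNorm_map hdeg hgen]; push_cast; rfl
  have hs0 : (s : K) ≠ 0 := by
    intro h
    rw [h, Algebra.norm_zero] at hN
    have : ((Ideal.absNorm p : ℕ) : ℚ) = 0 := by
      apply pow_eq_zero_iff (two_ne_zero) |>.1 hN.symm
    exact hp0 (Ideal.absNorm_eq_zero_iff.1 (by exact_mod_cast this))
  have hmem : galRestrict ℤ ℚ K (𝓞 K) (σ ^ 3) s ∈ Ideal.span {s} := by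
    rw [← hs]; apply aux_stable; rw [hs]; exact Ideal.mem_span_singleton_self s
  obtain ⟨w, hw⟩ := Ideal.mem_span_singleton'.1 hmem
  have hw' : (σ ^ 3) (s : K) = (w : K) * (s : K) := by
    rw [← map_mul, hw]; exact (aux_galRestrict _ _).symm
  obtain ⟨a, ha, h1, h2⟩ := aux_real_good hdeg hgen hβ hs0 hN (RingOfIntegers.isIntegral_coe w) hw' hg
  refine ⟨a, ha, by rw [auxPsi_eq hdeg hgen hβ hs hg, h1], ?_⟩
  have h3 : a ^ 2 = (Ideal.absNorm p : ℤ) ^ 2 := by exact_mod_cast h2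
  exact sq_eq_sq_iff_eq_or_eq_neg.1 h3

/-- in a finite field with `q` elements and `q ≡ 3 mod 4` there is no square root of `-1` -/
lemma aux_no_root {k : Type*} [Field k] [Finite k] {b : k} (hb : b ^ 2 = -1)
    (h2 : (2 : k) ≠ 0) (hq : Nat.card k % 4 = 3) : False := by
  classical
  let _ : Fintype k := Fintype.ofFinite k
  have h := FiniteField.pow_card b
  rw [← Nat.card_eq_fintype_card] at h
  obtain ⟨m, hm⟩ : ∃ m, Nat.card k = 2 * (2 * m + 1) + 1 := ⟨Nat.card k / 4, by omega⟩
  rw [hm, pow_succ, pow_mul, hb, Odd.neg_one_pow ⟨m, rfl⟩] at h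
  exact h2 (by linear_combination (2 : k) * hb * 0 + (b : k) * h + 2 * hb)

/-- in a finite field with `q` elements and `q ≡ 1 mod 4` there is a square root of `-1` -/
lemma aux_root {k : Type*} [Field k] [Finite k] (hq : Nat.card k % 4 = 1) :
    ∃ c : k, c ^ 2 = -1 := by
  classical
  let _ : Fintype k := Fintype.ofFinite k
  obtain ⟨c, hc⟩ := FiniteField.isSquare_neg_one_iff.2 (by rw [← Nat.card_eq_fintype_card (α := k)]; omega)
  exact ⟨c, by rw [hc]; ring⟩

lemma aux_four {P Q : Ideal (𝓞 K)} (hc : IsCoprime P (Ideal.span {(4 : 𝓞 K)})) (hle : P ≤ Q)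
    (hQ : Q.IsPrime) : (4 : 𝓞 K) ∉ Q := by
  intro h4
  obtain ⟨i, hi, j, hj, hij⟩ := Ideal.isCoprime_iff_exists.1 hc
  obtain ⟨y, rfl⟩ := Ideal.mem_span_singleton'.1 hj
  exact hQ.ne_top ((Ideal.eq_top_iff_one Q).2 (hij ▸ Q.add_mem (hle hi) (Q.mul_mem_left _ h4)))

lemma aux_card_le {σ : K ≃ₐ[ℚ] K} {p : Ideal (𝓞 (cubicFixedField σ))} (hp : p.IsPrime)
    (hp0 : p ≠ ⊥) {Q : Ideal (𝓞 K)} (hQ : Q.IsPrime) (hQ0 : Q ≠ ⊥)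
    (hle : Ideal.map (algebraMap (𝓞 (cubicFixedField σ)) (𝓞 K)) p ≤ Q) :
    Ideal.absNorm p ≤ Ideal.absNorm Q := by
  have hmax : p.IsMaximal := hp.isMaximal hp0
  let _ : Field (𝓞 (cubicFixedField σ) ⧸ p) := Ideal.Quotient.field p
  have hfin : Finite (𝓞 K ⧸ Q) := Ideal.finiteQuotientOfFreeOfNeBot Q hQ0
  have hnt : Nontrivial (𝓞 K ⧸ Q) := Ideal.Quotient.nontrivial_iff.2 hQ.ne_top
  let f : (𝓞 (cubicFixedField σ) ⧸ p) →+* (𝓞 K ⧸ Q) :=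
    Ideal.quotientMap Q (algebraMap (𝓞 (cubicFixedField σ)) (𝓞 K)) (Ideal.map_le_iff_le_comap.1 hle)
  have := Nat.card_le_card_of_injective f f.injective
  exact this

lemma aux_split [IsGalois ℚ K] (hdeg : Module.finrank ℚ K = 6) {σ : K ≃ₐ[ℚ] K}
    (hgen : ∀ τ : K ≃ₐ[ℚ] K, τ ∈ Subgroup.zpowers σ) {β : K} (hβ : β ^ 2 = -1)
    {p : Ideal (𝓞 (cubicFixedField σ))} (hp : p.IsPrime) (hp0 : p ≠ ⊥)
    (hc : IsCoprime (Ideal.map (algebraMap (𝓞 (cubicFixedField σ)) (𝓞 K)) p)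
      (Ideal.span {(4 : 𝓞 K)})) {Q₁ Q₂ : Ideal (𝓞 K)} (h1 : Q₁.IsPrime) (h2 : Q₂.IsPrime)
    (h : Ideal.map (algebraMap (𝓞 (cubicFixedField σ)) (𝓞 K)) p = Q₁ * Q₂) :
    Ideal.absNorm p % 4 ≠ 3 := by
  intro h3
  have hN := aux_absNorm_map hdeg hgen p
  rw [h, map_mul] at hN
  have hq0 : 0 < Ideal.absNorm p := by omega
  have hb : ∀ Q : Ideal (𝓞 K), Ideal.absNorm Q = 0 ↔ Q = ⊥ := fun Q => Ideal.absNorm_eq_zero_iff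
  have hq2 : 0 < Ideal.absNorm p ^ 2 := by positivity
  have hQ1 : Q₁ ≠ ⊥ := fun h' => by
    rw [(hb _).2 h', zero_mul] at hN; omega
  have hQ2 : Q₂ ≠ ⊥ := fun h' => by
    rw [(hb _).2 h', mul_zero] at hN; omega
  have l1 := aux_card_le hp hp0 h1 hQ1 (h ▸ Ideal.mul_le_left)
  have l2 := aux_card_le hp hp0 h2 hQ2 (h ▸ Ideal.mul_le_right)
  have he : Ideal.absNorm Q₁ = Ideal.absNorm p := by nlinarith
  have hmax : Q₁.IsMaximal := h1.isMaximal hQ1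
  let _ : Field (𝓞 K ⧸ Q₁) := Ideal.Quotient.field Q₁
  have hfin : Finite (𝓞 K ⧸ Q₁) := Ideal.finiteQuotientOfFreeOfNeBot Q₁ hQ1
  obtain ⟨bb, hbc⟩ : ∃ bb : 𝓞 K, algebraMap (𝓞 K) K bb = β := ⟨⟨β, aux_beta_int hβ⟩, rfl⟩
  have hbb : bb ^ 2 = -1 := RingOfIntegers.ext (by simpa [← hbc] using hβ)
  refine aux_no_root (b := Ideal.Quotient.mk Q₁ bb) ?_ ?_ (k := 𝓞 K ⧸ Q₁) ?_
  · have := congrArg (Ideal.Quotient.mk Q₁) hbb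
    simpa only [map_pow, map_neg, map_one] using this
  · intro h'
    refine aux_four hc (h ▸ Ideal.mul_le_left) h1 (Ideal.Quotient.eq_zero_iff_mem.1 ?_)
    have : (4 : 𝓞 K) = 2 * 2 := by norm_num
    rw [this, map_mul, map_ofNat, h', mul_zero]
  · rw [← h3, ← he]; rfl

lemma aux_inert [IsGalois ℚ K] {σ : K ≃ₐ[ℚ] K}
    (hgen : ∀ τ : K ≃ₐ[ℚ] K, τ ∈ Subgroup.zpowers σ) {β : K} (hβ : β ^ 2 = -1)
    {p : Ideal (𝓞 (cubicFixedField σ))} (hp : p.IsPrime) (hp0 : p ≠ ⊥)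
    (hc : IsCoprime (Ideal.map (algebraMap (𝓞 (cubicFixedField σ)) (𝓞 K)) p)
      (Ideal.span {(4 : 𝓞 K)}))
    (h : (Ideal.map (algebraMap (𝓞 (cubicFixedField σ)) (𝓞 K)) p).IsPrime) :
    Ideal.absNorm p % 4 ≠ 1 := by
  intro h1
  have hmax : p.IsMaximal := hp.isMaximal hp0
  let _ : Field (𝓞 (cubicFixedField σ) ⧸ p) := Ideal.Quotient.field p
  have hfin : Finite (𝓞 (cubicFixedField σ) ⧸ p) := Ideal.finiteQuotientOfFreeOfNeBot p hp0
  obtain ⟨c, hcc⟩ := aux_root (k := 𝓞 (cubicFixedField σ) ⧸ p) h1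
  obtain ⟨c, rfl⟩ := Ideal.Quotient.mk_surjective c
  have hmem : c ^ 2 + 1 ∈ p := by
    rw [← Ideal.Quotient.eq_zero_iff_mem, map_add, map_pow, hcc, map_one]; ring
  have hσβ := aux_sigma_beta hgen hβ
  obtain ⟨bb, hbc⟩ : ∃ bb : 𝓞 K, algebraMap (𝓞 K) K bb = β := ⟨⟨β, aux_beta_int hβ⟩, rfl⟩
  have hbb : bb ^ 2 = -1 := RingOfIntegers.ext (by simpa [← hbc] using hβ)
  have hρ : galRestrict ℤ ℚ K (𝓞 K) (σ ^ 3) bb = -bb := by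
    apply RingOfIntegers.ext
    rw [RingOfIntegers.coe_eq_algebraMap, aux_galRestrict, RingOfIntegers.coe_eq_algebraMap, map_neg, hbc,
      (aux_pow_apply _ _).2.1]
    simp only [hσβ, map_neg, neg_neg]
  have hm := Ideal.mem_map_of_mem (algebraMap (𝓞 (cubicFixedField σ)) (𝓞 K)) hmem
  have hfix := aux_fix σ c
  have h4 := aux_four hc le_rfl h
  have hst := fun x => aux_stable σ p (x := x)
  set P := Ideal.map (algebraMap (𝓞 (cubicFixedField σ)) (𝓞 K)) p
  rw [map_add, map_pow, map_one] at hm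
  set C := algebraMap (𝓞 (cubicFixedField σ)) (𝓞 K) c
  have hm2 : (C + bb) * (C - bb) ∈ P := by
    have : (C + bb) * (C - bb) = C ^ 2 + 1 := by linear_combination -hbb
    rwa [this]
  have hboth : C + bb ∈ P ∧ C - bb ∈ P := by
    rcases h.mem_or_mem hm2 with h' | h'
    · refine ⟨h', ?_⟩
      have := hst _ h'
      rwa [map_add, hfix, hρ, ← sub_eq_add_neg] at this
    · refine ⟨?_, h'⟩
      have := hst _ h'
      rwa [map_sub, hfix, hρ, sub_neg_eq_add] at this
  apply h4
  have := P.mul_mem_left (-2 * bb) (P.sub_mem hboth.1 hboth.2)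
  have he : (4 : 𝓞 K) = -2 * bb * (C + bb - (C - bb)) := by linear_combination 4 * hbb
  rwa [he]

lemma aux_prim_ne {β : K} (hβ : β ^ 2 = -1) : ¬ auxPrim β (0 : K) := by
  rintro ⟨a, b, h, hb, hab⟩
  have := aux_inj hβ (a := 0) (b := 0) (c := a) (d := b) (by push_cast; linear_combination h)
  omega

lemma auxPhi_ne {σ : K ≃ₐ[ℚ] K} {β : K} (hβ : β ^ 2 = -1) {x : K}
    (h : auxPrim β (auxNu σ x)) : auxPhi σ x ≠ 0 := by
  have hx : x ≠ 0 := by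
    rintro rfl
    apply aux_prim_ne hβ
    simpa [auxNu] using h
  simp only [auxPhi]
  exact mul_ne_zero (mul_ne_zero hx (by simpa using hx)) (by simpa using hx)

lemma aux_idealConj (τ : K ≃ₐ[ℚ] K) (t : 𝓞 K) :
    idealConj τ (Ideal.span {t}) = Ideal.span {galRestrict ℤ ℚ K (𝓞 K) τ t} := by
  rw [idealConj, Ideal.map_span, Set.image_singleton]

lemma aux_main [IsGalois ℚ K] (hdeg : Module.finrank ℚ K = 6) {σ : K ≃ₐ[ℚ] K}
    (hgen : ∀ τ : K ≃ₐ[ℚ] K, τ ∈ Subgroup.zpowers σ) {β : K} (hβ : β ^ 2 = -1)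
    [IsPrincipalIdealRing (𝓞 K)] :
    IsShimuraIdealChar σ (Ideal.span {(4 : 𝓞 K)}) (auxPsi σ β) := by
  have hex := fun {I} => aux_exists_good hdeg hgen hβ (I := I)
  have hpsi := fun {I t} => auxPsi_eq hdeg hgen hβ (I := I) (t := t)
  refine ⟨?_, ?_, ?_, ?_, ?_, ?_⟩
  · intro I _ hc
    obtain ⟨t, hI, ht⟩ := hex hc
    rw [hpsi hI ht]
    exact auxPhi_ne hβ ht
  · intro I J _ _ hI hJ
    obtain ⟨s, hI, hs⟩ := hex hI
    obtain ⟨t, hJ, ht⟩ := hex hJ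
    rw [hpsi hI hs, hpsi hJ ht, ← auxPhi_mul]
    refine (hpsi (t := s * t) ?_ ?_).trans ?_
    · rw [hI, hJ, Ideal.span_singleton_mul_span_singleton]
    · rw [RingOfIntegers.coe_eq_algebraMap, map_mul, auxNu_mul]
      exact aux_prim_mul hβ hs ht
    · rw [RingOfIntegers.coe_eq_algebraMap, map_mul]
  · intro s _ hs
    obtain ⟨y, hy⟩ := Ideal.mem_span_singleton'.1 hs
    refine (hpsi rfl ?_).trans ?_
    · have h4 : (algebraMap (𝓞 K) K) 4 = 4 := map_ofNat _ 4
      have : (s : K) = 1 + 4 * (y : K) := by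
        have := congrArg (algebraMap (𝓞 K) K) hy
        simp only [map_sub, map_mul, map_one, h4] at this
        linear_combination -this
      rw [this]
      exact aux_good_of_one_mod hdeg hgen hβ (RingOfIntegers.isIntegral_coe y)
    · rfl
  · intro p hp hp0 hc
    obtain ⟨a, ha, hψ, h⟩ := aux_prime_val hdeg hgen hβ hp0 hc
    have hcard : Nat.card (𝓞 (cubicFixedField σ) ⧸ p) = Ideal.absNorm p := rfl
    rw [hcard, hψ]
    constructor
    · rintro ⟨Q₁, Q₂, h1, h2, -, hQ⟩
      have := aux_split hdeg hgen hβ hp hp0 hc h1 h2 hQ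
      rcases h with h | h
      · rw [h]; simp
      · omega
    · intro hP
      have := aux_inert hgen hβ hp hp0 hc hP
      rcases h with h | h
      · omega
      · rw [h]; simp
  · intro I _ hc
    obtain ⟨t, hI, ht⟩ := hex hc
    rw [hpsi hI ht]
    constructor
    · rw [← auxPhi_norm hdeg hgen, ← aux_absNorm hdeg hgen hβ, ← hI]
      have hcard : Nat.card (𝓞 K ⧸ I) = Ideal.absNorm I := rfl
      rw [hcard]; simp
    · rw [hI, aux_idealConj, aux_idealConj, Ideal.span_singleton_mul_span_singleton,
        Ideal.span_singleton_mul_span_singleton, FractionalIdeal.coeIdeal_span_singleton,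
        map_mul, map_mul, aux_galRestrict, aux_galRestrict]
      rfl
  · intro I _ hc
    obtain ⟨t, hI, ht⟩ := hex hc
    rw [hpsi hI ht]
    refine (hpsi (t := galRestrict ℤ ℚ K (𝓞 K) σ t) ?_ ?_).trans ?_
    · rw [hI, aux_idealConj]
    · rw [RingOfIntegers.coe_eq_algebraMap, aux_galRestrict, auxNu_sigma]
      exact aux_prim_sigma hgen hβ ht
    · rw [RingOfIntegers.coe_eq_algebraMap, aux_galRestrict, auxPhi_sigma]

end aux

/-- For the sextic cyclic CM field ℚ(α, i) of conductor 28 there exists a Shimura ideal character. -/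
theorem stmt_7 (K : Type*) [Field K] [NumberField K]
    (hdeg : Module.finrank ℚ K = 6) [IsGalois ℚ K] (hcyc : IsCyclic (K ≃ₐ[ℚ] K))
    (α β : K) (hα : α ^ 3 = 21 * α - 7) (hβ : β ^ 2 = (-1 : K)) :
    ∃ (σ : K ≃ₐ[ℚ] K) (𝔠 : Ideal (𝓞 K)) (ψ : Ideal (𝓞 K) → K),
      (∀ τ : K ≃ₐ[ℚ] K, τ ∈ Subgroup.zpowers σ) ∧ 𝔠 ≠ ⊥ ∧
      IsShimuraIdealChar σ 𝔠 ψ := by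
  have hz : ((α + 1) / 3) ^ 3 = ((α + 1) / 3) ^ 2 + 2 * ((α + 1) / 3) - 1 := by
    linear_combination (1 / 27) * hα
  obtain ⟨σ, hgen, hσz⟩ := aux_exists_gen hcyc hz
  have := aux_pid hdeg hgen hβ hz hσz
  refine ⟨σ, Ideal.span {4}, auxPsi σ β, hgen, ?_, aux_main hdeg hgen hβ⟩
  rw [Ne, Ideal.span_singleton_eq_bot]
  norm_num
end

section
/- Let K be a number field of degree 6 over ℚ that is Galois over ℚ with cyclic Galois group, and suppose K contains elements α and β with α³ = 21α − 7 and β² = −2 (so K is the sextic cyclic CM field ℚ(α, √−2) of conductor 56). Then there exist a generator σ of Gal(K/ℚ), a nonzero ideal 𝔠 of 𝒪_K, and a Shimura ideal character of type (σ, 𝔠). -/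
open NumberField

/-- The explicit data attached to the field. -/
structure SData (K : Type*) [Field K] [NumberField K] [IsGalois ℚ K] where
  σ : K ≃ₐ[ℚ] K
  gen : ∀ τ : K ≃ₐ[ℚ] K, τ ∈ Subgroup.zpowers σ
  ord : orderOf σ = 6
  fr : Module.finrank ℚ K = 6
  b : 𝓞 K
  z : 𝓞 K
  hb : b ^ 2 = -2
  hz : z ^ 3 = z ^ 2 + 2 * z - 1
  gb : galRestrict ℤ ℚ K (𝓞 K) σ b = - b
  gz : galRestrict ℤ ℚ K (𝓞 K) σ z = 2 - z ^ 2

section setup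
variable {K : Type*} [Field K] [NumberField K] [IsGalois ℚ K]

lemma fixed_int (σ : K ≃ₐ[ℚ] K) (gen : ∀ τ : K ≃ₐ[ℚ] K, τ ∈ Subgroup.zpowers σ)
    (x : 𝓞 K) (hx : galRestrict ℤ ℚ K (𝓞 K) σ x = x) : ∃ n : ℤ, x = n := by
  have h1 : σ (x : K) = x := by
    have := algebraMap_galRestrict_apply (A := ℤ) (K := ℚ) (L := K) (B := 𝓞 K) σ x
    rw [hx] at this
    exact this.symm
  have h2 : (x : K) ∈ (⊥ : IntermediateField ℚ K) := by
    rw [IsGalois.mem_bot_iff_fixed]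
    intro τ
    obtain ⟨k, rfl⟩ := Subgroup.mem_zpowers_iff.mp (gen τ)
    have : σ ∈ MulAction.stabilizer (K ≃ₐ[ℚ] K) (x : K) := h1
    exact (MulAction.stabilizer (K ≃ₐ[ℚ] K) (x : K)).zpow_mem this k
  obtain ⟨q, hq⟩ := IntermediateField.mem_bot.mp h2
  have h3 : IsIntegral ℤ q := by
    have : IsIntegral ℤ (x : K) := RingOfIntegers.isIntegral_coe x
    have h4 : IsIntegral ℤ (algebraMap ℚ K q) := by rw [hq]; exact this
    exact (isIntegral_algebraMap_iff (algebraMap ℚ K).injective).mp h4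
  obtain ⟨n, hn⟩ := IsIntegrallyClosed.isIntegral_iff.mp h3
  refine ⟨n, RingOfIntegers.ext ?_⟩
  rw [← hq, ← hn]
  simp

lemma exists_SData (hdeg : Module.finrank ℚ K = 6) (hcyc : IsCyclic (K ≃ₐ[ℚ] K))
    (α β : K) (hα : α ^ 3 = 21 * α - 7) (hβ : β ^ 2 = (-2 : K)) : Nonempty (SData K) := by
  obtain ⟨σ, gen⟩ := hcyc.exists_generator
  have ord : orderOf σ = 6 := by
    rw [orderOf_eq_card_of_forall_mem_zpowers gen, IsGalois.card_aut_eq_finrank, hdeg]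
  have hib : IsIntegral ℤ β := by
    refine ⟨Polynomial.X ^ 2 + Polynomial.C 2, by monicity!, ?_⟩
    simp [hβ]
  have hzK : ((α + 1) / 3) ^ 3 = ((α + 1) / 3) ^ 2 + 2 * ((α + 1) / 3) - 1 := by
    field_simp
    linear_combination hα
  have hiz : IsIntegral ℤ ((α + 1) / 3) := by
    refine ⟨Polynomial.X ^ 3 - Polynomial.X ^ 2 - 2 * Polynomial.X + 1, by monicity!, ?_⟩
    simp only [Polynomial.eval₂_add, Polynomial.eval₂_sub, Polynomial.eval₂_X_pow, Polynomial.eval₂_mul, Polynomial.eval₂_ofNat, Polynomial.eval₂_X, Polynomial.eval₂_one]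
    linear_combination hzK
  obtain ⟨b, hbe⟩ : ∃ b : 𝓞 K, (b : K) = β := ⟨⟨β, hib⟩, rfl⟩
  obtain ⟨z, hze⟩ : ∃ b : 𝓞 K, (b : K) = (α + 1) / 3 := ⟨⟨_, hiz⟩, rfl⟩
  have hb : b ^ 2 = -2 := by
    apply RingOfIntegers.ext
    change algebraMap (𝓞 K) K _ = algebraMap (𝓞 K) K _
    rw [map_pow, map_neg, map_ofNat]
    rw [← hbe] at hβ
    exact hβ
  have hz : z ^ 3 = z ^ 2 + 2 * z - 1 := by
    apply RingOfIntegers.ext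
    rw [← hze] at hzK
    change algebraMap (𝓞 K) K _ = algebraMap (𝓞 K) K _
    rw [map_pow, map_sub, map_add, map_mul, map_pow, map_ofNat, map_one]
    exact hzK
  set g := galRestrict ℤ ℚ K (𝓞 K) σ with hg
  have gb : g b = - b := by
    have h1 : (g b) ^ 2 = b ^ 2 := by rw [← map_pow, hb, map_neg, map_ofNat]
    rcases sq_eq_sq_iff_eq_or_eq_neg.mp h1 with h | h
    · exfalso
      obtain ⟨n, rfl⟩ := fixed_int σ gen b h
      have : n ^ 2 = -2 := by exact_mod_cast hb
      nlinarith [sq_nonneg n]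
    · exact h
  have gz : g z = 2 - z ^ 2 ∨ g z = z ^ 2 - z - 1 := by
    have h1 : (g z) ^ 3 = (g z) ^ 2 + 2 * (g z) - 1 := by
      rw [← map_pow, hz, map_sub, map_add, map_mul, map_pow, map_ofNat, map_one]
    have h2 : (g z - z) * ((g z - (2 - z ^ 2)) * (g z - (z ^ 2 - z - 1))) = 0 := by
      linear_combination h1 + (-(g z) * z + z ^ 2 - 1) * hz
    rcases mul_eq_zero.mp h2 with h | h
    · exfalso
      obtain ⟨n, rfl⟩ := fixed_int σ gen z (sub_eq_zero.mp h)
      have : n ^ 3 = n ^ 2 + 2 * n - 1 := by exact_mod_cast hz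
      have h5 := congrArg (Int.cast : ℤ → ZMod 2) this
      push_cast at h5
      generalize (n : ZMod 2) = m at h5
      revert m; decide
    · rcases mul_eq_zero.mp h with h | h
      · left; exact sub_eq_zero.mp h
      · right; exact sub_eq_zero.mp h
  rcases gz with gz | gz
  · exact ⟨⟨σ, gen, ord, hdeg, b, z, hb, hz, gb, gz⟩⟩
  · refine ⟨⟨σ⁻¹, ?_, by simpa using ord, hdeg, b, z, hb, hz, ?_, ?_⟩⟩
    · simpa using gen
    · rw [map_inv, ← hg]
      change g.symm b = -b
      rw [AlgEquiv.symm_apply_eq, map_neg, gb, neg_neg]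
    · rw [map_inv, ← hg]
      change g.symm z = _
      rw [AlgEquiv.symm_apply_eq]
      simp only [map_sub, map_pow, gz, map_ofNat]
      linear_combination (-1 + z) * hz
end setup

namespace SData
variable {K : Type*} [Field K] [NumberField K] [IsGalois ℚ K] (D : SData K)

/-- the generator acting on integers -/
noncomputable def g : 𝓞 K ≃ₐ[ℤ] 𝓞 K := galRestrict ℤ ℚ K (𝓞 K) D.σ

lemma coe_g (x : 𝓞 K) : ((D.g x : 𝓞 K) : K) = D.σ x :=
  algebraMap_galRestrict_apply (A := ℤ) (K := ℚ) (L := K) (B := 𝓞 K) D.σ x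

lemma gb' : D.g D.b = - D.b := D.gb
lemma gz' : D.g D.z = 2 - D.z ^ 2 := D.gz

lemma fixed (x : 𝓞 K) (hx : D.g x = x) : ∃ n : ℤ, x = n := fixed_int D.σ D.gen x hx

lemma σ6 (x : K) : D.σ (D.σ (D.σ (D.σ (D.σ (D.σ x))))) = x := by
  have : D.σ ^ 6 = 1 := by rw [← D.ord]; exact pow_orderOf_eq_one _
  exact DFunLike.congr_fun this x

lemma g6 (x : 𝓞 K) : D.g (D.g (D.g (D.g (D.g (D.g x))))) = x := by
  apply RingOfIntegers.ext
  simp only [coe_g, σ6]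

lemma g2z : D.g (D.g D.z) = D.z ^ 2 - D.z - 1 := by
  simp only [gz', map_sub, map_pow, map_ofNat]
  linear_combination (-1 - D.z) * D.hz

lemma g3z : D.g (D.g (D.g D.z)) = D.z := by
  rw [g2z]
  simp only [gz', map_sub, map_pow, map_one]
  linear_combination (1 + D.z) * D.hz

lemma exists_range (τ : K ≃ₐ[ℚ] K) : ∃ i < 6, D.σ ^ i = τ := by
  have := D.gen τ
  rw [← mem_powers_iff_mem_zpowers, ] at this
  classical
  rw [mem_powers_iff_mem_range_orderOf, D.ord] at this
  simpa using this

lemma prod_aut {M : Type*} [CommMonoid M] (f : (K ≃ₐ[ℚ] K) → M) :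
    ∏ τ, f τ = f 1 * f D.σ * f (D.σ ^ 2) * f (D.σ ^ 3) * f (D.σ ^ 4) * f (D.σ ^ 5) := by
  have : ∏ τ, f τ = ∏ i ∈ Finset.range 6, f (D.σ ^ i) := by
    symm
    refine Finset.prod_bij (fun i _ => D.σ ^ i) (by simp) ?_ ?_ (by simp)
    · intro i hi j hj h
      exact pow_injOn_Iio_orderOf (by simpa [D.ord] using hi) (by simpa [D.ord] using hj) h
    · intro τ _
      obtain ⟨i, hi, h⟩ := D.exists_range τ
      exact ⟨i, by simpa using hi, h⟩
  rw [this]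
  simp [Finset.prod_range_succ]

lemma sum_aut {M : Type*} [AddCommMonoid M] (f : (K ≃ₐ[ℚ] K) → M) :
    ∑ τ, f τ = f 1 + f D.σ + f (D.σ ^ 2) + f (D.σ ^ 3) + f (D.σ ^ 4) + f (D.σ ^ 5) :=
  D.prod_aut (M := Multiplicative M) f

lemma norm_eq (x : 𝓞 K) : ((Algebra.norm ℤ x : ℤ) : 𝓞 K) =
    x * D.g x * D.g (D.g x) * D.g (D.g (D.g x)) * D.g (D.g (D.g (D.g x))) *
      D.g (D.g (D.g (D.g (D.g x)))) := by
  apply RingOfIntegers.ext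
  have := Algebra.norm_eq_prod_automorphisms ℚ (x : K)
  rw [D.prod_aut, ← Algebra.coe_norm_int] at this
  simp only [map_mul, coe_g]
  simpa using this

lemma trace_eq (x : 𝓞 K) : ((Algebra.trace ℤ (𝓞 K) x : ℤ) : 𝓞 K) =
    x + D.g x + D.g (D.g x) + D.g (D.g (D.g x)) + D.g (D.g (D.g (D.g x))) +
      D.g (D.g (D.g (D.g (D.g x)))) := by
  apply RingOfIntegers.ext
  have := trace_eq_sum_automorphisms (K := ℚ) (x : K)
  rw [D.sum_aut, ← Algebra.coe_trace_int] at this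
  simp only [map_add, coe_g]
  simpa using this

end SData

namespace SData
variable {K : Type*} [Field K] [NumberField K] [IsGalois ℚ K] (D : SData K)

/-- six integers -/
noncomputable def v : Fin 6 → 𝓞 K :=
  ![1, D.z, D.z ^ 2, D.b, D.z * D.b, D.z ^ 2 * D.b]

lemma trz_cast (k : ℕ) : ((Algebra.trace ℤ (𝓞 K) (D.z ^ k) : ℤ) : 𝓞 K) =
    2 * (D.z ^ k + (2 - D.z ^ 2) ^ k + (D.z ^ 2 - D.z - 1) ^ k) := by
  rw [D.trace_eq]
  simp only [map_pow]
  rw [g3z, g2z, gz']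
  ring

lemma trzb (k : ℕ) : Algebra.trace ℤ (𝓞 K) (D.z ^ k * D.b) = 0 := by
  have : ((Algebra.trace ℤ (𝓞 K) (D.z ^ k * D.b) : ℤ) : 𝓞 K) = ((0 : ℤ) : 𝓞 K) := by
    rw [D.trace_eq]
    simp only [map_pow, map_mul]
    rw [g3z, g2z, gz']
    simp only [gb', map_neg]
    push_cast
    ring
  exact_mod_cast this

lemma tr0 : Algebra.trace ℤ (𝓞 K) (D.z ^ 0) = 6 := by
  have : ((Algebra.trace ℤ (𝓞 K) (D.z ^ 0) : ℤ) : 𝓞 K) = ((6 : ℤ) : 𝓞 K) := by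
    rw [D.trz_cast]; push_cast; ring
  exact_mod_cast this

lemma tr1 : Algebra.trace ℤ (𝓞 K) (D.z ^ 1) = 2 := by
  have : ((Algebra.trace ℤ (𝓞 K) (D.z ^ 1) : ℤ) : 𝓞 K) = ((2 : ℤ) : 𝓞 K) := by
    rw [D.trz_cast]; push_cast; ring
  exact_mod_cast this

lemma z4 : D.z ^ 4 = 3 * D.z ^ 2 + D.z - 1 := by
  linear_combination (D.z + 1) * D.hz

lemma p2 : D.z ^ 2 + (2 - D.z ^ 2) ^ 2 + (D.z ^ 2 - D.z - 1) ^ 2 = 5 := by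
  linear_combination (2 * D.z) * D.hz

lemma tr2 : Algebra.trace ℤ (𝓞 K) (D.z ^ 2) = 10 := by
  have : ((Algebra.trace ℤ (𝓞 K) (D.z ^ 2) : ℤ) : 𝓞 K) = ((10 : ℤ) : 𝓞 K) := by
    rw [D.trz_cast, D.p2]; push_cast; ring
  exact_mod_cast this

lemma root2 : (2 - D.z ^ 2) ^ 3 = (2 - D.z ^ 2) ^ 2 + 2 * (2 - D.z ^ 2) - 1 := by
  rw [← gz']
  simpa only [map_pow, map_sub, map_add, map_mul, map_one, map_ofNat] using congrArg D.g D.hz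

lemma root3 : (D.z ^ 2 - D.z - 1) ^ 3 = (D.z ^ 2 - D.z - 1) ^ 2 + 2 * (D.z ^ 2 - D.z - 1) - 1 := by
  rw [← g2z]
  simpa only [map_pow, map_sub, map_add, map_mul, map_one, map_ofNat] using
    congrArg (fun t => D.g (D.g t)) D.hz

lemma p3 : D.z ^ 3 + (2 - D.z ^ 2) ^ 3 + (D.z ^ 2 - D.z - 1) ^ 3 = 4 := by
  rw [root2, root3]
  linear_combination D.hz + D.p2

lemma p4 : D.z ^ 4 + (2 - D.z ^ 2) ^ 4 + (D.z ^ 2 - D.z - 1) ^ 4 = 13 := by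
  linear_combination D.z * D.hz + (2 - D.z ^ 2) * D.root2 + (D.z ^ 2 - D.z - 1) * D.root3 +
    2 * D.p2 + D.p3

lemma tr3 : Algebra.trace ℤ (𝓞 K) (D.z ^ 3) = 8 := by
  have : ((Algebra.trace ℤ (𝓞 K) (D.z ^ 3) : ℤ) : 𝓞 K) = ((8 : ℤ) : 𝓞 K) := by
    rw [D.trz_cast, D.p3]; push_cast; ring
  exact_mod_cast this

lemma tr4 : Algebra.trace ℤ (𝓞 K) (D.z ^ 4) = 26 := by
  have : ((Algebra.trace ℤ (𝓞 K) (D.z ^ 4) : ℤ) : 𝓞 K) = ((26 : ℤ) : 𝓞 K) := by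
    rw [D.trz_cast, D.p4]; push_cast; ring
  exact_mod_cast this

lemma trzbb (k : ℕ) : Algebra.trace ℤ (𝓞 K) (D.z ^ k * D.b ^ 2) =
    -2 * Algebra.trace ℤ (𝓞 K) (D.z ^ k) := by
  have h : D.z ^ k * D.b ^ 2 = (-2 : ℤ) • D.z ^ k := by
    rw [D.hb, zsmul_eq_mul]; push_cast; ring
  rw [h, map_smul, smul_eq_mul]

lemma traceMat : Algebra.traceMatrix ℤ D.v =
    !![6, 2, 10, 0, 0, 0;
       2, 10, 8, 0, 0, 0;
       10, 8, 26, 0, 0, 0;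
       0, 0, 0, -12, -4, -20;
       0, 0, 0, -4, -20, -16;
       0, 0, 0, -20, -16, -52] := by
  have key : ∀ (k e : ℕ) (x y : 𝓞 K) , x * y = D.z ^ k * D.b ^ e →
      Algebra.traceForm ℤ (𝓞 K) x y = Algebra.trace ℤ (𝓞 K) (D.z ^ k * D.b ^ e) := by
    intro k e x y h
    rw [Algebra.traceForm_apply, h]
  have q0 := D.tr0; have q1 := D.tr1; have q2 := D.tr2; have q3 := D.tr3; have q4 := D.tr4
  ext i j
  rw [Algebra.traceMatrix_apply]
  fin_cases i <;> fin_cases j <;>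
  simp only [v, Matrix.of_apply, Matrix.cons_val', Matrix.cons_val, Fin.zero_eta, Fin.mk_one, Fin.reduceFinMk]
  · rw [key 0 0 _ _ (by ring), pow_zero D.b, mul_one, q0]
  · rw [key 1 0 _ _ (by ring), pow_zero D.b, mul_one, q1]
  · rw [key 2 0 _ _ (by ring), pow_zero D.b, mul_one, q2]
  · rw [key 0 1 _ _ (by ring), pow_one D.b, trzb]
  · rw [key 1 1 _ _ (by ring), pow_one D.b, trzb]
  · rw [key 2 1 _ _ (by ring), pow_one D.b, trzb]
  · rw [key 1 0 _ _ (by ring), pow_zero D.b, mul_one, q1]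
  · rw [key 2 0 _ _ (by ring), pow_zero D.b, mul_one, q2]
  · rw [key 3 0 _ _ (by ring), pow_zero D.b, mul_one, q3]
  · rw [key 1 1 _ _ (by ring), pow_one D.b, trzb]
  · rw [key 2 1 _ _ (by ring), pow_one D.b, trzb]
  · rw [key 3 1 _ _ (by ring), pow_one D.b, trzb]
  · rw [key 2 0 _ _ (by ring), pow_zero D.b, mul_one, q2]
  · rw [key 3 0 _ _ (by ring), pow_zero D.b, mul_one, q3]
  · rw [key 4 0 _ _ (by ring), pow_zero D.b, mul_one, q4]
  · rw [key 2 1 _ _ (by ring), pow_one D.b, trzb]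
  · rw [key 3 1 _ _ (by ring), pow_one D.b, trzb]
  · rw [key 4 1 _ _ (by ring), pow_one D.b, trzb]
  · rw [key 0 1 _ _ (by ring), pow_one D.b, trzb]
  · rw [key 1 1 _ _ (by ring), pow_one D.b, trzb]
  · rw [key 2 1 _ _ (by ring), pow_one D.b, trzb]
  · rw [key 0 2 _ _ (by ring), trzbb, q0]; norm_num
  · rw [key 1 2 _ _ (by ring), trzbb, q1]; norm_num
  · rw [key 2 2 _ _ (by ring), trzbb, q2]; norm_num
  · rw [key 1 1 _ _ (by ring), pow_one D.b, trzb]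
  · rw [key 2 1 _ _ (by ring), pow_one D.b, trzb]
  · rw [key 3 1 _ _ (by ring), pow_one D.b, trzb]
  · rw [key 1 2 _ _ (by ring), trzbb, q1]; norm_num
  · rw [key 2 2 _ _ (by ring), trzbb, q2]; norm_num
  · rw [key 3 2 _ _ (by ring), trzbb, q3]; norm_num
  · rw [key 2 1 _ _ (by ring), pow_one D.b, trzb]
  · rw [key 3 1 _ _ (by ring), pow_one D.b, trzb]
  · rw [key 4 1 _ _ (by ring), pow_one D.b, trzb]
  · rw [key 2 2 _ _ (by ring), trzbb, q2]; norm_num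
  · rw [key 3 2 _ _ (by ring), trzbb, q3]; norm_num
  · rw [key 4 2 _ _ (by ring), trzbb, q4]; norm_num

lemma discr_v : Algebra.discr ℤ D.v = -1229312 := by
  rw [Algebra.discr_def, traceMat]
  simp [Matrix.det_succ_row_zero, Fin.sum_univ_succ, Fin.succAbove]

lemma abs_discr_le (D : SData K) : |discr K| ≤ 1229312 := by
  have hr : Module.finrank ℤ (𝓞 K) = 6 := by rw [RingOfIntegers.rank, D.fr]
  let B : Module.Basis (Fin 6) ℤ (𝓞 K) := Module.finBasisOfFinrankEq ℤ (𝓞 K) hr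
  rw [← NumberField.discr_eq_discr K B]
  have h := Algebra.discr_of_matrix_vecMul (A := ℤ) B (B.toMatrix D.v)
  rw [Module.Basis.toMatrix_map_vecMul, D.discr_v] at h
  have h2 := congrArg abs h
  rw [abs_mul, abs_pow] at h2
  norm_num at h2
  have h3 : (B.toMatrix D.v).det ≠ 0 := by
    intro h0; rw [h0] at h; norm_num at h
  have h4 : 1 ≤ (B.toMatrix D.v).det ^ 2 := by
    have := sq_pos_of_ne_zero h3
    omega
  nlinarith [abs_nonneg (Algebra.discr ℤ B)]

open Module InfinitePlace Nat Real in
lemma minkowski_lt (D : SData K) : (4 / π) ^ nrComplexPlaces K *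
  ((finrank ℚ K)! / (finrank ℚ K) ^ (finrank ℚ K) * √|discr K|) < 36 := by
  have h1 : nrComplexPlaces K ≤ 3 := by
    have := InfinitePlace.card_add_two_mul_card_eq_rank K
    rw [D.fr] at this
    omega
  have h2 : √|(discr K : ℝ)| ≤ 1109 := by
    rw [Real.sqrt_le_left (by norm_num)]
    have := D.abs_discr_le
    have : ((|discr K| : ℤ) : ℝ) ≤ 1229312 := by exact_mod_cast this
    push_cast at this
    linarith
  have hpi := Real.pi_gt_d2
  have h3 : (4 / π) ≤ 4 / 3.14 := by gcongr
  have h4 : 1 ≤ 4 / π := by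
    rw [one_le_div Real.pi_pos]; exact Real.pi_le_four
  have h5 : (4 / π) ^ nrComplexPlaces K ≤ (4 / 3.14) ^ 3 :=
    (pow_le_pow_right₀ h4 h1).trans (by gcongr)
  rw [D.fr]
  have h6 : ((6 ! : ℕ) : ℝ) = 720 := by norm_num [Nat.factorial]
  rw [h6]
  calc _ ≤ (4 / 3.14 : ℝ) ^ 3 * (720 / ((6 : ℕ) : ℝ) ^ 6 * 1109) := by gcongr
    _ < 36 := by norm_num

end SData


lemma zmod_no_root (p : ℕ) (hp : p.Prime) (hp36 : p < 36)
    (y w : ZMod p) (hy : y ^ 3 = y ^ 2 + 2 * y - 1) (hw : w ^ 2 = -2) : False := by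
  have hy' : ∃ y : ZMod p, y ^ 3 = y ^ 2 + 2 * y - 1 := ⟨y, hy⟩
  have hw' : ∃ w : ZMod p, w ^ 2 = -2 := ⟨w, hw⟩
  clear hy hw y w
  interval_cases p <;> first | (revert hp; norm_num; done) | (clear hp; revert hy'; decide) |
    (clear hp; revert hw'; decide)

lemma finite_field_card (L : Type*) [Field L] [Fintype L] (h : Fintype.card L < 36)
    (y w : L) (hy : y ^ 3 = y ^ 2 + 2 * y - 1) (hw : w ^ 2 = -2) :
    Fintype.card L = 8 ∨ Fintype.card L = 16 ∨ Fintype.card L = 32 ∨ Fintype.card L = 27 := by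
  by_cases hpr : (Fintype.card L).Prime
  · exfalso
    let e := (ZMod.ringEquivOfPrime L hpr rfl).symm
    refine zmod_no_root _ hpr h (e y) (e w) ?_ ?_
    · rw [← map_pow, hy]; simp only [map_sub, map_add, map_mul, map_pow, map_ofNat, map_one]
    · rw [← map_pow, hw]; simp only [map_neg, map_ofNat]
  have hpp : IsPrimePow (Fintype.card L) := FiniteField.isPrimePow_card L
  have hcast : ((Fintype.card L : ℕ) : L) = 0 := FiniteField.cast_card_eq_zero L
  have hpow := FiniteField.pow_card y
  generalize Fintype.card L = q at *
  obtain ⟨p, n, hp, hn, hq⟩ := (isPrimePow_nat_iff q).mp hpp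
  have hn5 : n < 6 := by
    by_contra hcon
    have : 2 ^ 6 ≤ p ^ n := (Nat.pow_le_pow_left hp.two_le 6).trans
      (Nat.pow_le_pow_right hp.pos (by omega))
    omega
  have hn1 : n ≠ 1 := by rintro rfl; rw [pow_one] at hq; exact hpr (hq ▸ hp)
  have hn2 : 2 ≤ n := by omega
  clear hn hn1
  have hp6 : p < 6 := by
    by_contra hcon
    have : 6 ^ 2 ≤ p ^ n := (Nat.pow_le_pow_left (by omega) 2).trans
      (Nat.pow_le_pow_right hp.pos (by omega))
    omega
  have hpL : (p : L) = 0 := by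
    rw [← hq] at hcast
    push_cast at hcast
    exact pow_eq_zero_iff (by omega) |>.mp hcast
  interval_cases p
  · exact absurd hp (by norm_num)
  · exact absurd hp (by norm_num)
  · interval_cases n
    · exfalso
      subst hq
      push_cast at hpL
      norm_num at hpow
      have h1 : y ^ 2 = 1 := by
        grind
      have h2 : y = 0 := by grind
      rw [h2] at h1
      norm_num at h1
    all_goals omega
  · interval_cases n
    · exfalso
      subst hq
      push_cast at hpL
      norm_num at hpow
      have h1 : y ^ 9 = - y ^ 2 - 1 := by
        grind
      have h2 : (y - 1) ^ 2 = 0 := by grind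
      have h3 : y = 1 := by
        have := pow_eq_zero_iff (two_ne_zero) |>.mp h2
        linear_combination this
      rw [h3] at hy
      have : (1 : L) = 0 := by linear_combination hpL - hy - hpL + 1 * (0 : L) * hpL
      exact one_ne_zero this
    all_goals omega
  · exact absurd hp (by norm_num)
  · interval_cases n
    · exfalso
      subst hq
      push_cast at hpL
      norm_num at hpow
      have h0 : y ^ 5 = 2 - y ^ 2 := by grind
      have h1 : y ^ 25 = (2 - (2 - y ^ 2) ^ 2) := by
        rw [show y ^ 25 = (y ^ 5) ^ 5 by ring, h0]
        grind
      have : (1 : L) = 0 := by grind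
      exact one_ne_zero this
    all_goals omega

namespace SData
variable {K : Type*} [Field K] [NumberField K] [IsGalois ℚ K] (D : SData K)

lemma natAbs_norm_b : (Algebra.norm ℤ D.b).natAbs = 8 := by
  have h : ((Algebra.norm ℤ D.b : ℤ) : 𝓞 K) = ((8 : ℤ) : 𝓞 K) := by
    rw [D.norm_eq]
    simp only [gb', map_neg]
    have h2 : D.b ^ 6 = -8 := by linear_combination (D.b ^ 4 - 2 * D.b ^ 2 + 4) * D.hb
    push_cast
    linear_combination - h2
  have : Algebra.norm ℤ D.b = 8 := by exact_mod_cast h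
  rw [this]; rfl

lemma natAbs_norm_1b : (Algebra.norm ℤ (1 + D.b)).natAbs = 27 ∧
    (Algebra.norm ℤ (1 - D.b)).natAbs = 27 := by
  have h3 : (1 + D.b) * (1 - D.b) = 3 := by linear_combination - D.hb
  have e1 : (1 + D.b) * (1 - D.b) * (1 + D.b) * (1 - D.b) * (1 + D.b) * (1 - D.b) = 27 := by
    rw [show (1 + D.b) * (1 - D.b) * (1 + D.b) * (1 - D.b) * (1 + D.b) * (1 - D.b) =
      ((1 + D.b) * (1 - D.b)) ^ 3 by ring, h3]; norm_num
  constructor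
  · have h : ((Algebra.norm ℤ (1 + D.b) : ℤ) : 𝓞 K) = ((27 : ℤ) : 𝓞 K) := by
      rw [D.norm_eq]
      simp only [gb', map_neg, map_add, map_one]
      push_cast
      linear_combination e1
    have : Algebra.norm ℤ (1 + D.b) = 27 := by exact_mod_cast h
    rw [this]; rfl
  · have h : ((Algebra.norm ℤ (1 - D.b) : ℤ) : 𝓞 K) = ((27 : ℤ) : 𝓞 K) := by
      rw [D.norm_eq]
      simp only [gb', map_neg, map_sub, map_one]
      push_cast
      linear_combination e1
    have : Algebra.norm ℤ (1 - D.b) = 27 := by exact_mod_cast h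
    rw [this]; rfl

lemma eq_span_of_absNorm (P : Ideal (𝓞 K)) (x : 𝓞 K) (hx : x ∈ P) (n : ℕ) (hn : n ≠ 0)
    (h1 : (Algebra.norm ℤ x).natAbs = n) (h2 : Ideal.absNorm P = n) : P = Ideal.span {x} := by
  have hle : Ideal.span {x} ≤ P := (Ideal.span_singleton_le_iff_mem _).mpr hx
  obtain ⟨J, hJ⟩ := Ideal.dvd_iff_le.mpr hle
  have := congrArg Ideal.absNorm hJ
  rw [map_mul, Ideal.absNorm_span_singleton, h1, h2] at this
  have hJ1 : Ideal.absNorm J = 1 := by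
    have h5 : n * 1 = n * Ideal.absNorm J := by rw [mul_one]; exact this
    exact (Nat.eq_of_mul_eq_mul_left (Nat.pos_of_ne_zero hn) h5).symm
  rw [Ideal.absNorm_eq_one_iff] at hJ1
  rw [hJ, hJ1, Ideal.mul_top]

theorem pid (D : SData K) : IsPrincipalIdealRing (𝓞 K) := by
  apply RingOfIntegers.isPrincipalIdealRing_of_isPrincipal_of_norm_le_of_isPrime
  rintro ⟨P, hP0⟩ hP hle
  have hlt : Ideal.absNorm P < 36 := by
    have := lt_of_le_of_lt hle D.minkowski_lt
    exact_mod_cast this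
  simp only at hP ⊢
  have hP0' : P ≠ ⊥ := mem_nonZeroDivisors_iff_ne_zero.mp hP0
  have hmax : P.IsMaximal := hP.isMaximal hP0'
  let _ : Field (𝓞 K ⧸ P) := Ideal.Quotient.field P
  have : Finite (𝓞 K ⧸ P) := Ideal.finiteQuotientOfFreeOfNeBot P hP0'
  let _ : Fintype (𝓞 K ⧸ P) := Fintype.ofFinite _
  have hcard : Ideal.absNorm P = Fintype.card (𝓞 K ⧸ P) := by
    rw [Ideal.absNorm_apply, Submodule.cardQuot_apply, Nat.card_eq_fintype_card]
  have hmem := Ideal.absNorm_mem P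
  have key := finite_field_card (𝓞 K ⧸ P) (hcard ▸ hlt) (Ideal.Quotient.mk P D.z)
    (Ideal.Quotient.mk P D.b)
    (by rw [← map_pow, D.hz]; simp only [map_sub, map_add, map_mul, map_pow, map_ofNat, map_one])
    (by rw [← map_pow, D.hb]; simp only [map_neg, map_ofNat])
  rw [← hcard] at key
  have two : (2 : 𝓞 K) ∈ P → Ideal.absNorm P ∣ 8 ∧ D.b ∈ P := by
    intro h2
    have hb : D.b ∈ P := by
      apply hP.mem_of_pow_mem 2
      rw [D.hb]; exact P.neg_mem h2
    have := Ideal.absNorm_dvd_norm_of_mem hb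
    rw [← Int.dvd_natAbs, D.natAbs_norm_b] at this
    exact ⟨by exact_mod_cast this, hb⟩
  rcases key with h | h | h | h
  · have h2 : (2 : 𝓞 K) ∈ P := by
      rw [h] at hmem
      apply hP.mem_of_pow_mem 3
      convert hmem using 1; norm_num
    exact ⟨D.b, eq_span_of_absNorm P D.b (two h2).2 8 (by norm_num) D.natAbs_norm_b h⟩
  · have h2 : (2 : 𝓞 K) ∈ P := by
      rw [h] at hmem
      apply hP.mem_of_pow_mem 4
      convert hmem using 1; norm_num
    have := (two h2).1
    rw [h] at this; norm_num at this
  · have h2 : (2 : 𝓞 K) ∈ P := by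
      rw [h] at hmem
      apply hP.mem_of_pow_mem 5
      convert hmem using 1; norm_num
    have := (two h2).1
    rw [h] at this; norm_num at this
  · have h2 : (3 : 𝓞 K) ∈ P := by
      rw [h] at hmem
      apply hP.mem_of_pow_mem 3
      convert hmem using 1; norm_num
    have h3 : (1 + D.b) * (1 - D.b) ∈ P := by
      convert h2 using 1; linear_combination - D.hb
    rcases hP.mem_or_mem h3 with h4 | h4
    · exact ⟨_, eq_span_of_absNorm P _ h4 27 (by norm_num) D.natAbs_norm_1b.1 h⟩
    · exact ⟨_, eq_span_of_absNorm P _ h4 27 (by norm_num) D.natAbs_norm_1b.2 h⟩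
end SData


/-- sign of an even residue mod 4 -/
def sgn4 (b : ZMod 8) : ℤ := if b = 0 ∨ b = 4 then 1 else -1

/-- quadratic character on `ℤ[√-2]/8` -/
def e0 (a b : ZMod 8) : ℤ :=
  if b = 0 ∨ b = 2 ∨ b = 4 ∨ b = 6 then ZMod.χ₈' a * sgn4 b
  else ZMod.χ₈' (a + 2 * b) * sgn4 (b - a)

lemma e0_mul : ∀ a b c d : ZMod 8, e0 (a * c - 2 * b * d) (a * d + b * c) = e0 a b * e0 c d := by
  decide +kernel

lemma e0_neg : ∀ a b : ZMod 8, e0 a (-b) = e0 a b := by decide +kernel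

lemma e0_im : ∀ b : ZMod 8, e0 0 b = 0 := by decide +kernel

lemma e0_re : ∀ a : ZMod 8, e0 a 0 = ZMod.χ₈' a := by decide +kernel

lemma e0_val : ∀ a b : ZMod 8, e0 a b = 0 ∨ e0 a b = 1 ∨ e0 a b = -1 := by decide +kernel

/-- quadratic character on `ℤ[√-2]` -/
def ee (q : ℤ√(-2)) : ℤ := e0 q.re q.im

lemma ee_mul (p q : ℤ√(-2)) : ee (p * q) = ee p * ee q := by
  simp only [ee, ← e0_mul]
  simp only [Zsqrtd.re_mul, Zsqrtd.im_mul]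
  push_cast
  congr 1; ring

lemma ee_star (p : ℤ√(-2)) : ee (star p) = ee p := by
  simp [ee, e0_neg]

lemma ee_one_add (q : ℤ√(-2)) : ee (1 + 8 * q) = 1 := by
  have h8 : ((8 : ℤ) : ZMod 8) = 0 := by decide
  have h1 : (1 + 8 * q).re = 1 + 8 * q.re := by
    simp [Zsqrtd.re_mul]
  have h2 : (1 + 8 * q).im = 8 * q.im := by
    simp [Zsqrtd.im_mul]
  rw [ee, h1, h2]
  rw [Int.cast_add, Int.cast_mul, Int.cast_mul, h8]
  simp only [zero_mul, add_zero]
  decide +kernel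

namespace SData
variable {K : Type*} [Field K] [NumberField K] [IsGalois ℚ K] (D : SData K)

/-- embedding of `ℤ[√-2]` -/
noncomputable def ι : ℤ√(-2) →+* 𝓞 K :=
  Zsqrtd.lift ⟨D.b, by rw [← sq, D.hb]; push_cast; rfl⟩

lemma ι_apply (q : ℤ√(-2)) : D.ι q = q.re + q.im * D.b := rfl

lemma ι_inj : Function.Injective D.ι :=
  Zsqrtd.lift_injective _ (by intro n h; nlinarith [mul_self_nonneg n])

lemma g_ι (q : ℤ√(-2)) : D.g (D.ι q) = D.ι (star q) := by
  simp only [ι_apply, map_add, map_mul, map_intCast, gb', Zsqrtd.re_star, Zsqrtd.im_star]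
  push_cast; ring

lemma exists_ι (x : 𝓞 K) (hx : D.g (D.g x) = x) : ∃ q, D.ι q = x := by
  obtain ⟨t, ht⟩ := D.fixed (x + D.g x) (by rw [map_add, hx, add_comm])
  obtain ⟨m, hm⟩ := D.fixed ((x - D.g x) * D.b) (by
    rw [map_mul, map_sub, hx, gb']; ring)
  obtain ⟨n, hn⟩ := D.fixed (x * D.g x) (by rw [map_mul, hx, mul_comm])
  have hb := D.hb
  have h1 : 2 * t ^ 2 + m ^ 2 = 8 * n := by
    have : (((2 * t ^ 2 + m ^ 2 : ℤ)) : 𝓞 K) = ((8 * n : ℤ) : 𝓞 K) := by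
      push_cast
      rw [← ht, ← hm, ← hn]
      linear_combination (x - D.g x) ^ 2 * hb
    exact_mod_cast this
  have h4x : 4 * x = 2 * t - m * D.b := by
    rw [← ht, ← hm]
    linear_combination (x - D.g x) * hb
  have hm2 : 2 ∣ m := by
    have : 2 ∣ m ^ 2 := ⟨4 * n - t ^ 2, by linarith⟩
    exact Int.prime_two.dvd_of_dvd_pow this
  obtain ⟨m', rfl⟩ := hm2
  have ht2 : 2 ∣ t := by
    have : 2 ∣ t ^ 2 := ⟨2 * n - m' ^ 2, by linarith⟩
    exact Int.prime_two.dvd_of_dvd_pow this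
  obtain ⟨t', rfl⟩ := ht2
  have hm2 : 2 ∣ m' := by
    have : 2 ∣ m' ^ 2 := ⟨n - t' ^ 2, by linarith⟩
    exact Int.prime_two.dvd_of_dvd_pow this
  obtain ⟨m'', rfl⟩ := hm2
  refine ⟨⟨t', -m''⟩, ?_⟩
  rw [ι_apply]
  have h4 : (4 : 𝓞 K) ≠ 0 := by norm_num
  apply mul_left_cancel₀ h4
  rw [h4x]
  push_cast; ring

/-- relative norm to the quadratic subfield -/
noncomputable def N2 (x : 𝓞 K) : 𝓞 K := x * D.g (D.g x) * D.g (D.g (D.g (D.g x)))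

lemma exists_nn (x : 𝓞 K) : ∃ q, D.ι q = D.N2 x :=
  D.exists_ι _ (by simp only [N2, map_mul, g6]; ring)

/-- relative norm with values in `ℤ[√-2]` -/
noncomputable def nn (x : 𝓞 K) : ℤ√(-2) := (D.exists_nn x).choose

lemma ι_nn (x : 𝓞 K) : D.ι (D.nn x) = D.N2 x := (D.exists_nn x).choose_spec

lemma nn_mul (x y : 𝓞 K) : D.nn (x * y) = D.nn x * D.nn y := by
  apply D.ι_inj
  simp only [map_mul, ι_nn, N2]; ring

lemma nn_one : D.nn 1 = 1 := by
  apply D.ι_inj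
  simp only [ι_nn, N2, map_one, mul_one]

lemma nn_g (x : 𝓞 K) : D.nn (D.g x) = star (D.nn x) := by
  apply D.ι_inj
  rw [← g_ι]
  simp only [ι_nn, N2, map_mul]

lemma norm_nn (x : 𝓞 K) : Algebra.norm ℤ x = (D.nn x).norm := by
  have : ((Algebra.norm ℤ x : ℤ) : 𝓞 K) = (((D.nn x).norm : ℤ) : 𝓞 K) := by
    have h := congrArg D.ι (Zsqrtd.norm_eq_mul_conj (D.nn x))
    rw [map_mul, ← g_ι, ι_nn, map_intCast] at h
    rw [h, D.norm_eq]
    simp only [N2, map_mul]; ring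
  exact_mod_cast this

/-- the quadratic character on integers of `K` -/
noncomputable def ε (x : 𝓞 K) : ℤ := ee (D.nn x)

lemma ε_mul (x y : 𝓞 K) : D.ε (x * y) = D.ε x * D.ε y := by
  rw [ε, nn_mul, ee_mul]; rfl

lemma ε_g (x : 𝓞 K) : D.ε (D.g x) = D.ε x := by
  rw [ε, nn_g, ee_star]; rfl

lemma ε_one_add (t : 𝓞 K) : D.ε (1 + 8 * t) = 1 := by
  set t2 := D.g (D.g t) with h2
  set t4 := D.g (D.g (D.g (D.g t))) with h4
  obtain ⟨q, hq⟩ := D.exists_ι (t + t2 + t4 + 8 * (t * t2 + t * t4 + t2 * t4) + 64 * (t * t2 * t4))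
    (by simp only [h2, h4, map_add, map_mul, map_ofNat, g6]; ring)
  have : D.nn (1 + 8 * t) = 1 + 8 * q := by
    apply D.ι_inj
    rw [ι_nn, map_add, map_mul, hq]
    simp only [N2, map_add, map_mul, map_one, map_ofNat, ← h2, ← h4]
    ring
  rw [ε, this, ee_one_add]

lemma ε_val (x : 𝓞 K) : D.ε x = 0 ∨ D.ε x = 1 ∨ D.ε x = -1 := e0_val _ _

lemma ε_coprime (x : 𝓞 K) (h : IsCoprime (Ideal.span {x}) (Ideal.span {(8 : 𝓞 K)})) :
    D.ε x = 1 ∨ D.ε x = -1 := by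
  rw [Ideal.isCoprime_span_singleton_iff] at h
  obtain ⟨a, c, hac⟩ := h
  have h1 : D.ε (a * x) = 1 := by
    rw [show a * x = 1 + 8 * (-c) by linear_combination hac]
    exact D.ε_one_add _
  rw [ε_mul] at h1
  rcases D.ε_val x with h | h
  · rw [h] at h1; norm_num at h1
  · exact h

lemma unit_nn (u : 𝓞 K) (hu : IsUnit u) : (D.nn u).im = 0 ∧ ((D.nn u).re = 1 ∨ (D.nn u).re = -1) := by
  have h1 : IsUnit (D.nn u) := by
    obtain ⟨v, hv⟩ := hu.exists_right_inv
    apply IsUnit.of_mul_eq_one (D.nn v)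
    rw [← nn_mul, hv, nn_one]
  rw [← Zsqrtd.norm_eq_one_iff' (by norm_num), Zsqrtd.norm_def] at h1
  have h2 : (D.nn u).im = 0 := by
    by_contra h0
    have : 0 < (D.nn u).im ^ 2 := by positivity
    nlinarith [sq_nonneg (D.nn u).re]
  refine ⟨h2, ?_⟩
  rw [h2] at h1
  rw [← sq_eq_one_iff]
  linarith

lemma ε_unit (u : 𝓞 K) (hu : IsUnit u) : ((D.ε u : ℤ) : 𝓞 K) * D.N2 u = 1 := by
  rw [← ι_nn, ι_apply, ε, ee]
  obtain ⟨h1, h2 | h2⟩ := D.unit_nn u hu <;> rw [h1, h2]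
  · have : e0 ((1 : ℤ) : ZMod 8) ((0 : ℤ) : ZMod 8) = 1 := by decide +kernel
    rw [this]; push_cast; ring
  · have : e0 ((-1 : ℤ) : ZMod 8) ((0 : ℤ) : ZMod 8) = -1 := by decide +kernel
    rw [this]; push_cast; ring

end SData


namespace SData
variable {K : Type*} [Field K] [NumberField K] [IsGalois ℚ K] (D : SData K)

lemma no_sqrt (D : SData K) (x : 𝓞 K) (d : ℤ) (hd : d = 1 ∨ d = 3 ∨ d = 7) (hx : x ^ 2 = -(d : 𝓞 K)) :
    False := by
  have h1 : (D.g x) ^ 2 = x ^ 2 := by rw [← map_pow, hx, map_neg, map_intCast]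
  rcases sq_eq_sq_iff_eq_or_eq_neg.mp h1 with h | h
  · obtain ⟨n, rfl⟩ := D.fixed x h
    have : n ^ 2 = - d := by exact_mod_cast hx
    rcases hd with rfl | rfl | rfl <;> nlinarith [sq_nonneg n]
  · obtain ⟨n, hn⟩ := D.fixed (x * D.b) (by rw [map_mul, gb', h]; ring)
    have h2 : n ^ 2 = 2 * d := by
      have : ((n ^ 2 : ℤ) : 𝓞 K) = ((2 * d : ℤ) : 𝓞 K) := by
        push_cast
        rw [← hn, mul_pow, hx, D.hb]; ring
      exact_mod_cast this
    have h4 : n < 4 := by rcases hd with rfl | rfl | rfl <;> nlinarith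
    have h5 : -4 < n := by rcases hd with rfl | rfl | rfl <;> nlinarith
    rcases hd with rfl | rfl | rfl <;> interval_cases n <;> omega

lemma prime_root (D : SData K) (ξ : 𝓞 K) (p : ℕ) (hp : p.Prime) (hp2 : p ≠ 2)
    (h : IsPrimitiveRoot ξ p) : False := by
  have hK : IsPrimitiveRoot (ξ : K) p := h.map_of_injective RingOfIntegers.coe_injective
  have hm := Polynomial.cyclotomic_eq_minpoly_rat hK hp.pos
  have hdiv : (minpoly ℚ (ξ : K)).natDegree ∣ 6 := by
    rw [← D.fr]
    exact minpoly.degree_dvd (RingOfIntegers.isIntegral_coe ξ).tower_top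
  rw [← hm, Polynomial.natDegree_cyclotomic, Nat.totient_prime hp] at hdiv
  have hle := Nat.le_of_dvd (by norm_num) hdiv
  have hgeom := h.geom_sum_eq_zero hp.one_lt
  have hp8 : p < 8 := by omega
  interval_cases p <;> first | (revert hp; norm_num; done) | (revert hp2; norm_num; done) | skip
  · simp only [Finset.sum_range_succ, Finset.sum_range_zero] at hgeom
    refine D.no_sqrt (2 * ξ + 1) 3 (by norm_num) ?_
    push_cast
    linear_combination 4 * hgeom
  · norm_num at hdiv
  · simp only [Finset.sum_range_succ, Finset.sum_range_zero] at hgeom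
    refine D.no_sqrt (ξ + ξ ^ 2 + ξ ^ 4 - ξ ^ 3 - ξ ^ 5 - ξ ^ 6) 7 (by norm_num) ?_
    push_cast
    have h7 := h.pow_eq_one
    grind

lemma torsion (D : SData K) (u : 𝓞 K) (n : ℕ) (hn : 0 < n) (h : u ^ n = 1) : u = 1 ∨ u = -1 := by
  have hfin : IsOfFinOrder u := isOfFinOrder_iff_pow_eq_one.mpr ⟨n, hn, h⟩
  have hpos := hfin.orderOf_pos
  have hprim := IsPrimitiveRoot.orderOf u
  set m := orderOf u with hm
  by_cases h4 : 4 ∣ m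
  · exfalso
    obtain ⟨k, hk⟩ := h4
    have h5 : IsPrimitiveRoot (u ^ k) 4 := hprim.pow hpos (by rw [hk, mul_comm])
    have h6 : (u ^ k) ^ 2 = -1 := by
      have h8 : IsPrimitiveRoot ((u ^ k) ^ 2) 2 := h5.pow (by norm_num) (by norm_num)
      exact h8.eq_neg_one_of_two_right
    exact D.no_sqrt (u ^ k) 1 (by norm_num) (by rw [h6]; push_cast; ring)
  · have hodd : ∀ p, p.Prime → p ∣ m → p = 2 := by
      intro p hp hpm
      by_contra hp2
      obtain ⟨k, hk⟩ := hpm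
      exact D.prime_root (u ^ k) p hp hp2 (hprim.pow hpos (by rw [hk, mul_comm]))
    have hm2 : m ∣ 2 := by
      obtain ⟨k, hk⟩ : ∃ k, m = 2 ^ k := ⟨_, Nat.eq_prime_pow_of_unique_prime_dvd hpos.ne' (fun {d} hd hdm => hodd d hd hdm)⟩
      have : k < 2 := by
        by_contra hk2
        apply h4
        rw [hk]
        exact pow_dvd_pow 2 (show 2 ≤ k by omega)
      rw [hk]
      interval_cases k <;> norm_num
    have : u ^ 2 = 1 := orderOf_dvd_iff_pow_eq_one.mp hm2
    have h9 : (u - 1) * (u + 1) = 0 := by linear_combination this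
    rcases mul_eq_zero.mp h9 with h | h
    · left; linear_combination h
    · right; linear_combination h

lemma conj_eq (φ : K →+* ℂ) (x : 𝓞 K) :
    φ (D.g (D.g (D.g x)) : 𝓞 K) = starRingEnd ℂ (φ x) := by
  obtain ⟨τ, hτ⟩ := ComplexEmbedding.exists_comp_symm_eq_of_comp_eq (k := ℚ) φ
    ((starRingEnd ℂ).comp φ) (Subsingleton.elim _ _)
  obtain ⟨i, hi, hi2⟩ := D.exists_range τ.symm
  have key : ∀ y : K, φ ((D.σ ^ i) y) = starRingEnd ℂ (φ y) := by
    intro y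
    rw [hi2]
    exact DFunLike.congr_fun hτ y
  have h2 : D.σ ^ (i * 2) = 1 := by
    ext y
    apply φ.injective
    rw [pow_mul, sq, AlgEquiv.mul_apply, key, key]
    simp
  rw [← orderOf_dvd_iff_pow_eq_one, D.ord] at h2
  have h3 : i = 0 ∨ i = 3 := by omega
  rcases h3 with rfl | rfl
  · exfalso
    have h4 := key (D.b : K)
    rw [pow_zero, AlgEquiv.one_apply] at h4
    obtain ⟨r, hr⟩ := Complex.conj_eq_iff_real.mp h4.symm
    have h5 : (φ (D.b : K)) ^ 2 = -2 := by
      rw [← map_pow, ← map_pow, D.hb]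
      simp only [map_neg, map_ofNat]
    rw [hr] at h5
    have h6 : r ^ 2 = -2 := by exact_mod_cast h5
    nlinarith [sq_nonneg r]
  · rw [← key]
    simp only [coe_g]
    rfl

lemma g3_assoc (w : 𝓞 K) (hw : w ≠ 0) (h : Associated w (D.g (D.g (D.g w)))) :
    D.g (D.g (D.g w)) = w ∨ D.g (D.g (D.g w)) = - w := by
  obtain ⟨u, hu⟩ := h
  have h1 : ∀ φ : K →+* ℂ, ‖φ ((u : 𝓞 K) : K)‖ = 1 := by
    intro φ
    have h2 := D.conj_eq φ w
    have e : ((w * (u : 𝓞 K) : 𝓞 K) : K) = (w : K) * ((u : 𝓞 K) : K) := map_mul (algebraMap (𝓞 K) K) _ _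
    rw [← hu, e, map_mul] at h2
    have h3 := congrArg norm h2
    rw [norm_mul, Complex.norm_conj] at h3
    have h4 : ‖φ (w : K)‖ ≠ 0 := by
      rw [norm_ne_zero_iff, map_ne_zero]
      exact RingOfIntegers.coe_ne_zero_iff.mpr hw
    exact mul_left_cancel₀ h4 (by rw [h3, mul_one])
  obtain ⟨n, hn, hun⟩ := Embeddings.pow_eq_one_of_norm_eq_one K ℂ
    (RingOfIntegers.isIntegral_coe (u : 𝓞 K)) h1
  have : (u : 𝓞 K) ^ n = 1 := by
    apply RingOfIntegers.coe_injective
    simpa using hun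
  rcases D.torsion _ n hn this with h | h
  · left; rw [← hu, h, mul_one]
  · right; rw [← hu, h]; ring

lemma g3_N2 (w : 𝓞 K) (h : D.g (D.g (D.g w)) = w) : D.g (D.g (D.g (D.N2 w))) = D.N2 w := by
  have h1 := congrArg (fun t => t * D.g (D.g t) * D.g (D.g (D.g (D.g t)))) h
  simp only [N2, map_mul]
  exact h1

lemma g3_N2_neg (w : 𝓞 K) (h : D.g (D.g (D.g w)) = -w) :
    D.g (D.g (D.g (D.N2 w))) = - D.N2 w := by
  have h1 := congrArg (fun t => t * D.g (D.g t) * D.g (D.g (D.g (D.g t)))) h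
  simp only [map_neg] at h1
  simp only [N2, map_mul]
  rw [h1]; ring

lemma g3_unit (w : 𝓞 K) (hw : IsUnit w) : D.g (D.g (D.g w)) = w := by
  have hw' : IsUnit (D.g (D.g (D.g w))) := ((hw.map D.g).map D.g).map D.g
  rcases D.g3_assoc w hw.ne_zero
    ((associated_one_iff_isUnit.mpr hw).trans (associated_one_iff_isUnit.mpr hw').symm) with h | h
  · exact h
  · exfalso
    have h1 := D.g3_N2_neg w h
    rw [← ι_nn, ι_apply] at h1
    obtain ⟨h2, h3 | h3⟩ := D.unit_nn w hw <;> rw [h2, h3] at h1 <;>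
    · simp only [Int.cast_zero, zero_mul, add_zero, map_intCast] at h1
      norm_num at h1

end SData


namespace SData
variable {K : Type*} [Field K] [NumberField K] [IsGalois ℚ K] (D : SData K)

/-- the character on elements -/
noncomputable def Φ (s : 𝓞 K) : 𝓞 K :=
  (D.ε s : 𝓞 K) * (s * D.g (D.g (D.g (D.g s))) * D.g (D.g (D.g (D.g (D.g s)))))

lemma Φ_mul (s t : 𝓞 K) : D.Φ (s * t) = D.Φ s * D.Φ t := by
  simp only [Φ, ε_mul, map_mul, Int.cast_mul]; ring

lemma Φ_unit (u : 𝓞 K) (hu : IsUnit u) : D.Φ u = 1 := by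
  have h := D.g3_unit _ ((hu.map D.g).map D.g)
  rw [Φ, h, ← D.ε_unit u hu, N2]; ring

lemma Φ_assoc (s t : 𝓞 K) (h : Ideal.span {s} = Ideal.span {t}) : D.Φ s = D.Φ t := by
  rw [Ideal.span_singleton_eq_span_singleton] at h
  obtain ⟨u, rfl⟩ := h
  rw [Φ_mul, D.Φ_unit _ u.isUnit, mul_one]

lemma Φ_g (s : 𝓞 K) : D.Φ (D.g s) = D.g (D.Φ s) := by
  simp only [Φ, ε_g, map_mul, map_intCast]

/-- the ideal character -/
noncomputable def ψ (I : Ideal (𝓞 K)) : K :=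
  haveI := D.pid
  ((D.Φ (Submodule.IsPrincipal.generator I) : 𝓞 K) : K)

lemma ψ_span (s : 𝓞 K) : D.ψ (Ideal.span {s}) = (D.Φ s : 𝓞 K) := by
  have := D.pid
  rw [ψ]
  congr 1
  apply D.Φ_assoc
  exact Ideal.span_singleton_generator _

lemma exists_span (D : SData K) (I : Ideal (𝓞 K)) : ∃ s, I = Ideal.span {s} := by
  have := D.pid
  exact ⟨_, (Ideal.span_singleton_generator I).symm⟩

lemma conj_span (s : 𝓞 K) : idealConj D.σ (Ideal.span {s}) = Ideal.span {D.g s} := by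
  rw [idealConj, Ideal.map_span, Set.image_singleton]; rfl

lemma conj4_span (s : 𝓞 K) : idealConj (D.σ ^ 4) (Ideal.span {s}) =
    Ideal.span {D.g (D.g (D.g (D.g s)))} := by
  rw [idealConj, Ideal.map_span, Set.image_singleton, map_pow]; rfl

lemma conj5_span (s : 𝓞 K) : idealConj (D.σ ^ 5) (Ideal.span {s}) =
    Ideal.span {D.g (D.g (D.g (D.g (D.g s))))} := by
  rw [idealConj, Ideal.map_span, Set.image_singleton, map_pow]; rfl

lemma card_span (s : 𝓞 K) : (Nat.card (𝓞 K ⧸ Ideal.span {s}) : ℤ) = (D.nn s).norm := by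
  have h : Nat.card (𝓞 K ⧸ Ideal.span {s}) = Ideal.absNorm (Ideal.span {s}) := rfl
  rw [h, Ideal.absNorm_span_singleton, norm_nn, Int.natAbs_of_nonneg]
  exact Zsqrtd.norm_nonneg (by norm_num) _

lemma prop_iv1 (s : 𝓞 K) (h : D.ε s = 1 ∨ D.ε s = -1) :
    D.Φ s * D.g (D.g (D.g (D.Φ s))) = ((Nat.card (𝓞 K ⧸ Ideal.span {s}) : ℕ) : 𝓞 K) := by
  rw [← Int.cast_natCast, D.card_span, ← norm_nn, D.norm_eq]
  have h2 : ((D.ε s : ℤ) : 𝓞 K) * (D.ε s : ℤ) = 1 := by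
    rcases h with h | h <;> rw [h] <;> norm_num
  simp only [Φ, map_mul, map_intCast, g6]
  linear_combination (s * D.g s * D.g (D.g s) * D.g (D.g (D.g s)) * D.g (D.g (D.g (D.g s))) *
    D.g (D.g (D.g (D.g (D.g s))))) * h2

lemma prop_iv2 (s : 𝓞 K) (h : D.ε s = 1 ∨ D.ε s = -1) :
    FractionalIdeal.spanSingleton (nonZeroDivisors (𝓞 K)) ((D.Φ s : 𝓞 K) : K)
      = ((Ideal.span {s} * idealConj (D.σ ^ 4) (Ideal.span {s}) *
          idealConj (D.σ ^ 5) (Ideal.span {s}) : Ideal (𝓞 K)) :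
          FractionalIdeal (nonZeroDivisors (𝓞 K)) K) := by
  rw [conj4_span, conj5_span, Ideal.span_singleton_mul_span_singleton,
    Ideal.span_singleton_mul_span_singleton, FractionalIdeal.coeIdeal_span_singleton]
  rw [← FractionalIdeal.coeIdeal_span_singleton, ← FractionalIdeal.coeIdeal_span_singleton]
  congr 1
  rw [Φ]
  rcases h with h | h <;> rw [h]
  · simp
  · rw [Ideal.span_singleton_eq_span_singleton]
    simp

lemma Φ_ne (s : 𝓞 K) (hs : s ≠ 0) (h : D.ε s = 1 ∨ D.ε s = -1) : D.Φ s ≠ 0 := by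
  have : ∀ x, x ≠ 0 → D.g x ≠ 0 := fun x hx => by simpa using hx
  rw [Φ]
  refine mul_ne_zero ?_ (mul_ne_zero (mul_ne_zero hs ?_) ?_)
  · rcases h with h | h <;> rw [h] <;> norm_num
  · exact this _ (this _ (this _ (this _ hs)))
  · exact this _ (this _ (this _ (this _ (this _ hs))))

lemma coe_g4 (s : 𝓞 K) : ((D.g (D.g (D.g (D.g s))) : 𝓞 K) : K) = (D.σ ^ 4) (s : K) := by
  simp only [coe_g]; rfl

lemma coe_g5 (s : 𝓞 K) : ((D.g (D.g (D.g (D.g (D.g s)))) : 𝓞 K) : K) = (D.σ ^ 5) (s : K) := by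
  simp only [coe_g]; rfl

lemma coe_g3 (s : 𝓞 K) : ((D.g (D.g (D.g s)) : 𝓞 K) : K) = (D.σ ^ 3) (s : K) := by
  simp only [coe_g]; rfl

lemma coe_mul' (s t : 𝓞 K) : ((s * t : 𝓞 K) : K) = (s : K) * (t : K) :=
  map_mul (algebraMap (𝓞 K) K) s t

section cubic

lemma finrank_F : Module.finrank (cubicFixedField D.σ) K = 2 := by
  rw [cubicFixedField, IntermediateField.finrank_fixedField_eq_card, Nat.card_zpowers,
    orderOf_pow, D.ord]
  norm_num

lemma g3_F (y : 𝓞 (cubicFixedField D.σ)) :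
    D.g (D.g (D.g (algebraMap (𝓞 (cubicFixedField D.σ)) (𝓞 K) y))) =
      algebraMap (𝓞 (cubicFixedField D.σ)) (𝓞 K) y := by
  apply RingOfIntegers.coe_injective
  have h := coe_g3 D (algebraMap (𝓞 (cubicFixedField D.σ)) (𝓞 K) y)
  refine h.trans ?_
  have h2 : ((y : cubicFixedField D.σ) : K) ∈ cubicFixedField D.σ := (y : cubicFixedField D.σ).2
  exact h2 ⟨D.σ ^ 3, Subgroup.mem_zpowers _⟩

lemma absNorm_F (I : Ideal (𝓞 (cubicFixedField D.σ))) :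
    Nat.card (𝓞 K ⧸ Ideal.map (algebraMap (𝓞 (cubicFixedField D.σ)) (𝓞 K)) I) =
      Nat.card (𝓞 (cubicFixedField D.σ) ⧸ I) ^ 2 := by
  have h := Ideal.absNorm_algebraMap (𝓞 (cubicFixedField D.σ)) (𝓞 K) I
  have h2 : Module.finrank (𝓞 (cubicFixedField D.σ)) (𝓞 K) = 2 := by
    rw [← D.finrank_F]
    exact (IsFractionRing.finrank_eq (𝓞 (cubicFixedField D.σ)) (cubicFixedField D.σ) (𝓞 K) K).symm
  rw [h2] at h
  exact h

lemma g3_mem (I : Ideal (𝓞 (cubicFixedField D.σ))) (x : 𝓞 K)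
    (hx : x ∈ Ideal.map (algebraMap (𝓞 (cubicFixedField D.σ)) (𝓞 K)) I) :
    D.g (D.g (D.g x)) ∈ Ideal.map (algebraMap (𝓞 (cubicFixedField D.σ)) (𝓞 K)) I := by
  let G : 𝓞 K →+* 𝓞 K := ((D.g.toRingEquiv.toRingHom.comp D.g.toRingEquiv.toRingHom).comp D.g.toRingEquiv.toRingHom)
  change x ∈ Ideal.comap G (Ideal.map (algebraMap (𝓞 (cubicFixedField D.σ)) (𝓞 K)) I)
  suffices key : Ideal.map (algebraMap (𝓞 (cubicFixedField D.σ)) (𝓞 K)) I ≤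
      Ideal.comap G (Ideal.map (algebraMap (𝓞 (cubicFixedField D.σ)) (𝓞 K)) I) from key hx
  rw [Ideal.map_le_iff_le_comap]
  intro y hy
  change D.g (D.g (D.g (algebraMap (𝓞 (cubicFixedField D.σ)) (𝓞 K) y))) ∈
    Ideal.map (algebraMap (𝓞 (cubicFixedField D.σ)) (𝓞 K)) I
  rw [g3_F]
  exact Ideal.mem_map_of_mem _ hy

end cubic
end SData


namespace SData
variable {K : Type*} [Field K] [NumberField K] [IsGalois ℚ K] (D : SData K)

lemma chi_abs (a : ℤ) (q : ℕ) (h : (q : ℤ) ^ 2 = a ^ 2) : ZMod.χ₈' (a : ZMod 8) * a = ZMod.χ₈' (q : ZMod 8) * q := by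
  rcases sq_eq_sq_iff_eq_or_eq_neg.mp h with h | h
  · rw [← h]; simp
  · have h1 : ∀ c : ZMod 8, ZMod.χ₈' (-c) = - ZMod.χ₈' c := by decide
    have h2 : a = -(q : ℤ) := by omega
    rw [h2]
    push_cast
    rw [h1]; ring

lemma Φ_prime (I : Ideal (𝓞 (cubicFixedField D.σ))) (s : 𝓞 K) (hs : s ≠ 0)
    (hε : D.ε s = 1 ∨ D.ε s = -1)
    (hI : Ideal.map (algebraMap (𝓞 (cubicFixedField D.σ)) (𝓞 K)) I = Ideal.span {s}) :
    D.Φ s = ((ZMod.χ₈' ((Nat.card (𝓞 (cubicFixedField D.σ) ⧸ I) : ℕ) : ZMod 8) *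
      (Nat.card (𝓞 (cubicFixedField D.σ) ⧸ I) : ℕ) : ℤ) : 𝓞 K) := by
  have h1 : s ∣ D.g (D.g (D.g s)) := by
    rw [← Ideal.mem_span_singleton, ← hI]
    apply D.g3_mem
    rw [hI]; exact Ideal.mem_span_singleton_self s
  have h2 : D.g (D.g (D.g s)) ∣ s := by
    have := map_dvd D.g (map_dvd D.g (map_dvd D.g h1))
    rwa [g6] at this
  have hst : D.g (D.g (D.g (D.N2 s))) = D.ι (star (D.nn s)) := by
    rw [← ι_nn, g_ι, g_ι, g_ι, star_star]
  rcases D.g3_assoc s hs (associated_of_dvd_dvd h1 h2) with h | h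
  · have h3 := D.g3_N2 s h
    rw [hst, ← ι_nn] at h3
    have h4 := congrArg Zsqrtd.im (D.ι_inj h3)
    rw [Zsqrtd.im_star] at h4
    have h5 : (D.nn s).im = 0 := by omega
    have h6 := D.card_span s
    rw [← hI, absNorm_F, Zsqrtd.norm_def, h5] at h6
    rw [← chi_abs (D.nn s).re _ (by push_cast at h6; linarith)]
    have h7 : D.Φ s = (D.ε s : 𝓞 K) * D.N2 s := by
      have h8 : D.g (D.g (D.g (D.g (D.g s)))) = D.g (D.g s) := by rw [h]
      rw [Φ, N2, h8]; ring
    rw [h7, ← ι_nn, ι_apply, ε, ee, h5, Int.cast_zero, e0_re]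
    push_cast; ring
  · exfalso
    have h3 := D.g3_N2_neg s h
    rw [hst, ← ι_nn, ← map_neg] at h3
    have h4 := congrArg Zsqrtd.re (D.ι_inj h3)
    rw [Zsqrtd.re_star, Zsqrtd.re_neg] at h4
    have h5 : (D.nn s).re = 0 := by omega
    rw [ε, ee, h5, Int.cast_zero, e0_im] at hε
    omega

lemma two_not_mem (P J : Ideal (𝓞 K)) (hP : P.IsPrime) (hJ : J ≤ P)
    (h : IsCoprime J (Ideal.span {(8 : 𝓞 K)})) : (2 : 𝓞 K) ∉ P := by
  intro h2
  rw [Ideal.isCoprime_iff_exists] at h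
  obtain ⟨i, hi, j, hj, hij⟩ := h
  apply hP.ne_top
  rw [Ideal.eq_top_iff_one, ← hij]
  obtain ⟨t, rfl⟩ := Ideal.mem_span_singleton.mp hj
  refine P.add_mem (hJ hi) ?_
  rw [show (8 : 𝓞 K) * t = (4 * t) * 2 by ring]
  exact P.mul_mem_left _ h2

/-- value of the character on odd prime powers -/
lemma chi_val (q : ℕ) (hq : q % 2 = 1) :
    ZMod.χ₈' (q : ZMod 8) = if q % 8 ≠ 5 ∧ q % 8 ≠ 7 then 1 else -1 := by
  rw [ZMod.χ₈'_nat_eq_if_mod_eight]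
  have : q % 8 = 1 ∨ q % 8 = 3 ∨ q % 8 = 5 ∨ q % 8 = 7 := by omega
  rcases this with h | h | h | h <;> simp [h, hq]

lemma odd_card (L : Type*) [Field L] [Finite L] (h2 : (2 : L) ≠ 0) : Nat.card L % 2 = 1 := by
  have := Fintype.ofFinite L
  rw [Nat.card_eq_fintype_card]
  apply FiniteField.odd_card_of_char_ne_two
  intro h
  apply h2
  have := CharP.cast_eq_zero L (ringChar L)
  rw [h] at this
  exact_mod_cast this

lemma neg_two_iff (L : Type*) [Field L] [Finite L] :
    IsSquare (-2 : L) ↔ Nat.card L % 8 ≠ 5 ∧ Nat.card L % 8 ≠ 7 := by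
  have := Fintype.ofFinite L
  rw [Nat.card_eq_fintype_card]
  exact FiniteField.isSquare_neg_two_iff

lemma two_not_mem_F (I : Ideal (𝓞 (cubicFixedField D.σ)))
    (P : Ideal (𝓞 K)) (hP : (2 : 𝓞 K) ∉ P)
    (h : Ideal.map (algebraMap (𝓞 (cubicFixedField D.σ)) (𝓞 K)) I ≤ P) : (2 : 𝓞 (cubicFixedField D.σ)) ∉ I := by
  intro h2
  apply hP
  have := h (Ideal.mem_map_of_mem _ h2)
  rwa [map_ofNat] at this

lemma inert (I : Ideal (𝓞 (cubicFixedField D.σ))) (hI : I.IsPrime) (hI0 : I ≠ ⊥)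
    (hco : IsCoprime (Ideal.map (algebraMap (𝓞 (cubicFixedField D.σ)) (𝓞 K)) I) (Ideal.span {(8 : 𝓞 K)}))
    (hP : (Ideal.map (algebraMap (𝓞 (cubicFixedField D.σ)) (𝓞 K)) I).IsPrime) :
    ZMod.χ₈' ((Nat.card (𝓞 (cubicFixedField D.σ) ⧸ I) : ℕ) : ZMod 8) = -1 := by
  have h2 := two_not_mem _ _ hP le_rfl hco
  have h2F := D.two_not_mem_F I _ h2 le_rfl
  have hmax : I.IsMaximal := hI.isMaximal hI0
  let _ := Ideal.Quotient.field I
  have hfin : Finite (𝓞 (cubicFixedField D.σ) ⧸ I) := Ideal.finiteQuotientOfFreeOfNeBot I hI0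
  have hodd := odd_card (𝓞 (cubicFixedField D.σ) ⧸ I) (by
    intro h
    apply h2F
    rw [← Ideal.Quotient.eq_zero_iff_mem, map_ofNat]
    exact h)
  rw [chi_val _ hodd, if_neg]
  rw [← neg_two_iff]
  rintro ⟨x, hx⟩
  obtain ⟨x, rfl⟩ := Ideal.Quotient.mk_surjective x
  have hx2 : x * x + 2 ∈ I := by
    rw [← Ideal.Quotient.eq_zero_iff_mem, map_add, map_mul, map_ofNat, ← hx]
    exact neg_add_cancel _
  have h3 := Ideal.mem_map_of_mem (algebraMap (𝓞 (cubicFixedField D.σ)) (𝓞 K)) hx2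
  set y := algebraMap (𝓞 (cubicFixedField D.σ)) (𝓞 K) x with hy
  have hgy : D.g (D.g (D.g y)) = y := D.g3_F x
  have h4 : (y - D.b) * (y + D.b) ∈ Ideal.map (algebraMap (𝓞 (cubicFixedField D.σ)) (𝓞 K)) I := by
    convert h3 using 1
    rw [map_add, map_mul, map_ofNat, ← hy]
    linear_combination - D.hb
  have h5 : (y - D.b) ∈ Ideal.map (algebraMap (𝓞 (cubicFixedField D.σ)) (𝓞 K)) I ∧
      (y + D.b) ∈ Ideal.map (algebraMap (𝓞 (cubicFixedField D.σ)) (𝓞 K)) I := by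
    have e1 : D.g (D.g (D.g (y - D.b))) = y + D.b := by
      rw [map_sub, map_sub, map_sub, hgy, gb', map_neg, gb', map_neg, map_neg, gb']; ring
    have e2 : D.g (D.g (D.g (y + D.b))) = y - D.b := by
      rw [map_add, map_add, map_add, hgy, gb', map_neg, gb', map_neg, map_neg, gb']; ring
    rcases hP.mem_or_mem h4 with h | h
    · exact ⟨h, e1 ▸ D.g3_mem I _ h⟩
    · exact ⟨e2 ▸ D.g3_mem I _ h, h⟩
  have h6 : (2 : 𝓞 K) * 2 ∈ Ideal.map (algebraMap (𝓞 (cubicFixedField D.σ)) (𝓞 K)) I := by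
    have h7 := Ideal.mul_mem_left _ (-D.b) (Ideal.sub_mem _ h5.2 h5.1)
    convert h7 using 1
    linear_combination 2 * D.hb
  rcases hP.mem_or_mem h6 with h | h <;> exact h2 h

lemma card_le (I : Ideal (𝓞 (cubicFixedField D.σ))) (hI : I.IsMaximal)
    (Q : Ideal (𝓞 K)) (hQ : Q.IsPrime) (hQ0 : Q ≠ ⊥)
    (h : Ideal.map (algebraMap (𝓞 (cubicFixedField D.σ)) (𝓞 K)) I ≤ Q) :
    Nat.card (𝓞 (cubicFixedField D.σ) ⧸ I) ≤ Nat.card (𝓞 K ⧸ Q) := by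
  have hfin : Finite (𝓞 K ⧸ Q) := Ideal.finiteQuotientOfFreeOfNeBot Q hQ0
  let _ := Ideal.Quotient.field I
  have : Nontrivial (𝓞 K ⧸ Q) := Ideal.Quotient.nontrivial_iff.mpr hQ.ne_top
  exact Nat.card_le_card_of_injective _
    (Ideal.quotientMap Q (algebraMap (𝓞 (cubicFixedField D.σ)) (𝓞 K)) (Ideal.map_le_iff_le_comap.mp h)).injective

lemma split (I : Ideal (𝓞 (cubicFixedField D.σ))) (hI : I.IsPrime) (hI0 : I ≠ ⊥)
    (hco : IsCoprime (Ideal.map (algebraMap (𝓞 (cubicFixedField D.σ)) (𝓞 K)) I) (Ideal.span {(8 : 𝓞 K)}))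
    (Q₁ Q₂ : Ideal (𝓞 K)) (h1 : Q₁.IsPrime) (h2 : Q₂.IsPrime)
    (hQ : Ideal.map (algebraMap (𝓞 (cubicFixedField D.σ)) (𝓞 K)) I = Q₁ * Q₂) :
    ZMod.χ₈' ((Nat.card (𝓞 (cubicFixedField D.σ) ⧸ I) : ℕ) : ZMod 8) = 1 := by
  have hmax : I.IsMaximal := hI.isMaximal hI0
  have hne : Q₁ * Q₂ ≠ ⊥ := by
    rw [← hQ, Ne, Ideal.map_eq_bot_iff_of_injective (FaithfulSMul.algebraMap_injective _ _)]
    exact hI0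
  have hQ1 : Q₁ ≠ ⊥ := by rintro rfl; simp at hne
  have hQ2 : Q₂ ≠ ⊥ := by rintro rfl; simp at hne
  have hfin : Finite (𝓞 K ⧸ Q₁) := Ideal.finiteQuotientOfFreeOfNeBot Q₁ hQ1
  have hfinI : Finite (𝓞 (cubicFixedField D.σ) ⧸ I) := Ideal.finiteQuotientOfFreeOfNeBot I hI0
  have hpos : 0 < Nat.card (𝓞 (cubicFixedField D.σ) ⧸ I) := Nat.card_pos
  have hl1 := D.card_le I hmax Q₁ h1 hQ1 (hQ ▸ Ideal.mul_le_left)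
  have hl2 := D.card_le I hmax Q₂ h2 hQ2 (hQ ▸ Ideal.mul_le_right)
  have hmul : Nat.card (𝓞 K ⧸ Q₁) * Nat.card (𝓞 K ⧸ Q₂) = Nat.card (𝓞 (cubicFixedField D.σ) ⧸ I) ^ 2 := by
    rw [← D.absNorm_F, hQ]
    exact (map_mul Ideal.absNorm Q₁ Q₂).symm
  have heq : Nat.card (𝓞 (cubicFixedField D.σ) ⧸ I) = Nat.card (𝓞 K ⧸ Q₁) := by
    refine le_antisymm hl1 ?_
    nlinarith
  have h2n := two_not_mem _ _ h1 (hQ ▸ Ideal.mul_le_left) hco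
  have hmax1 : Q₁.IsMaximal := h1.isMaximal hQ1
  let _ := Ideal.Quotient.field Q₁
  have hodd := odd_card (𝓞 K ⧸ Q₁) (by
    intro h
    apply h2n
    rw [← Ideal.Quotient.eq_zero_iff_mem, map_ofNat]
    exact h)
  rw [heq, chi_val _ hodd, if_pos]
  rw [← neg_two_iff]
  refine ⟨Ideal.Quotient.mk Q₁ D.b, ?_⟩
  rw [← map_mul, ← sq, D.hb, map_neg, map_ofNat]

theorem main : IsShimuraIdealChar D.σ (Ideal.span {(8 : 𝓞 K)}) D.ψ := by
  refine ⟨?_, ?_, ?_, ?_, ?_, ?_⟩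
  · intro I hI hco
    obtain ⟨s, rfl⟩ := D.exists_span I
    rw [ψ_span]
    have hs : s ≠ 0 := by rintro rfl; simp at hI
    exact RingOfIntegers.coe_ne_zero_iff.mpr (D.Φ_ne s hs (D.ε_coprime s hco))
  · intro I J _ _ _ _
    obtain ⟨s, rfl⟩ := D.exists_span I
    obtain ⟨t, rfl⟩ := D.exists_span J
    rw [Ideal.span_singleton_mul_span_singleton, ψ_span, ψ_span, ψ_span, Φ_mul, coe_mul']
  · intro s _ hs
    obtain ⟨t, ht⟩ := Ideal.mem_span_singleton.mp hs
    have h1 : D.ε s = 1 := by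
      rw [show s = 1 + 8 * t by linear_combination ht]
      exact D.ε_one_add t
    rw [ψ_span, Φ, h1, Int.cast_one, one_mul, coe_mul', coe_mul', coe_g4, coe_g5]
  · intro I hI hI0 hco
    obtain ⟨s, hs⟩ := D.exists_span (Ideal.map (algebraMap (𝓞 (cubicFixedField D.σ)) (𝓞 K)) I)
    have hs0 : s ≠ 0 := by
      rintro rfl
      rw [Ideal.span_singleton_eq_bot.mpr rfl,
        Ideal.map_eq_bot_iff_of_injective (FaithfulSMul.algebraMap_injective _ _)] at hs
      exact hI0 hs
    have key := D.Φ_prime I s hs0 (D.ε_coprime s (hs ▸ hco)) hs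
    constructor
    · rintro ⟨Q₁, Q₂, h1, h2, -, hQ⟩
      rw [D.split I hI hI0 hco Q₁ Q₂ h1 h2 hQ, one_mul] at key
      rw [hs, ψ_span, key, Int.cast_natCast]
      exact map_natCast (algebraMap (𝓞 K) K) _
    · intro hP
      rw [D.inert I hI hI0 hco hP, neg_one_mul] at key
      rw [hs, ψ_span, key, Int.cast_neg, Int.cast_natCast]
      have := map_natCast (algebraMap (𝓞 K) K) (Nat.card (𝓞 (cubicFixedField D.σ) ⧸ I))
      rw [← this]
      exact map_neg (algebraMap (𝓞 K) K) _
  · intro I hI hco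
    obtain ⟨s, rfl⟩ := D.exists_span I
    rw [ψ_span]
    refine ⟨?_, D.prop_iv2 s (D.ε_coprime s hco)⟩
    rw [← coe_g3, ← coe_mul', D.prop_iv1 s (D.ε_coprime s hco)]
    exact map_natCast (algebraMap (𝓞 K) K) _
  · intro I hI hco
    obtain ⟨s, rfl⟩ := D.exists_span I
    rw [conj_span, ψ_span, ψ_span, Φ_g, coe_g]

end SData

/-- For the sextic cyclic CM field ℚ(α, √-2) of conductor 56 there exists a Shimura ideal character. -/
theorem stmt_8 (K : Type*) [Field K] [NumberField K]
    (hdeg : Module.finrank ℚ K = 6) [IsGalois ℚ K] (hcyc : IsCyclic (K ≃ₐ[ℚ] K))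
    (α β : K) (hα : α ^ 3 = 21 * α - 7) (hβ : β ^ 2 = (-2 : K)) :
    ∃ (σ : K ≃ₐ[ℚ] K) (𝔠 : Ideal (𝓞 K)) (ψ : Ideal (𝓞 K) → K),
      (∀ τ : K ≃ₐ[ℚ] K, τ ∈ Subgroup.zpowers σ) ∧ 𝔠 ≠ ⊥ ∧
      IsShimuraIdealChar σ 𝔠 ψ := by
  obtain ⟨D⟩ := exists_SData hdeg hcyc α β hα hβ
  exact ⟨D.σ, Ideal.span {(8 : 𝓞 K)}, D.ψ, D.gen, by simp, D.main⟩
end
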